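/- arXiv:1302.0580 — 5 statements merged into one kernel-verified Lean document; each statement's English description precedes it below -/
import Mathlib

section
/- For every Π⁰₁ equivalence relation E on ℕ there is a computable H : ℕ → ℕ → ℕ → Bool such that, setting F_n x y ↔ H n x y = true: each F_n is an equivalence relation on ℕ; F_{n+1} is contained in F_n for every n; and for all x, y: E x y ↔ ∀ n, F_n x y. -/
/-- A binary relation on ℕ is Π⁰₁. -/
def Pi01Rel (E : ℕ → ℕ → Prop) : Prop :=
  ∃ R : ℕ → ℕ → ℕ → Bool,
    Computable (fun p : ℕ × ℕ × ℕ => R p.1 p.2.1 p.2.2) ∧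
    ∀ x y, E x y ↔ ∀ t, R x y t = true

/-- Bounded universal quantification of a Boolean predicate. -/
def allLt (n : ℕ) (p : ℕ → Bool) : Bool :=
  Nat.rec true (fun i b => b && p i) n

theorem allLt_eq_true {n : ℕ} {p : ℕ → Bool} : allLt n p = true ↔ ∀ i < n, p i = true := by
  induction n with
  | zero => simp [allLt]
  | succ n ih =>
    have h : allLt (n + 1) p = (allLt n p && p n) := rfl
    rw [h, Bool.and_eq_true, ih, Nat.forall_lt_succ_right]

theorem Computable.allLt {α : Type*} [Primcodable α] {f : α → ℕ} {p : α → ℕ → Bool}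
    (hf : Computable f) (hp : Computable₂ p) : Computable fun a => allLt (f a) (p a) :=
  Computable.nat_rec (h := fun a q => q.2 && p a q.1) hf (Computable.const true)
    (Primrec.and.to_comp.comp (Computable.snd.comp Computable.snd)
      (hp.comp Computable.fst (Computable.fst.comp Computable.snd)))

section Coloring

variable (R : ℕ → ℕ → ℕ → Bool)

/-- By stage `t`, the number `z` has been separated from every entry of `L`
whose color differs from `b`. -/
def admissible (b : Bool) (L : List (ℕ × Bool)) (z t : ℕ) : Bool :=
  allLt L.length fun i =>
    ((L[i]?).getD (0, b)).2 == b || !allLt t (R z ((L[i]?).getD (0, b)).1)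

/-- Extend a partial two-coloring to `z`, waiting until some color is admissible. -/
def extendColoring (L : List (ℕ × Bool)) (z : ℕ) : Part (List (ℕ × Bool)) :=
  (Nat.rfind fun t => Part.some (admissible R true L z t || admissible R false L z t)).map
    fun t => (z, admissible R true L z t) :: L

/-- The coloring which separates `x` from `y` when `c` codes a triple `(x, y, t)` such that
`t` refutes the relation between `x` and `y`, and which is empty otherwise. -/
def seedColoring (c : ℕ) : List (ℕ × Bool) :=
  cond (R c.unpair.1 c.unpair.2.unpair.1 c.unpair.2.unpair.2) []
    [(c.unpair.1, true), (c.unpair.2.unpair.1, false)]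

/-- The extension of `seedColoring R c` to all numbers below `n`. -/
def coloring (c n : ℕ) : Part (List (ℕ × Bool)) :=
  Nat.rec (Part.some (seedColoring R c)) (fun z IH => IH.bind fun L => extendColoring R L z) n

variable {R}

theorem admissible_eq_true {b : Bool} {L : List (ℕ × Bool)} {z t : ℕ} :
    admissible R b L z t = true ↔ ∀ p ∈ L, p.2 = b ∨ ∃ s < t, R z p.1 s = false := by
  simp only [admissible, allLt_eq_true, List.forall_mem_iff_getElem, Bool.or_eq_true, beq_iff_eq,
    Bool.not_eq_true', ← Bool.not_eq_true, not_forall, exists_prop]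
  refine forall₂_congr fun i hi => ?_
  simp [List.getElem?_eq_getElem hi]

theorem computable_admissible (hR : Computable fun p : ℕ × ℕ × ℕ => R p.1 p.2.1 p.2.2)
    {α : Type*} [Primcodable α] (b : Bool) {L : α → List (ℕ × Bool)} {z t : α → ℕ}
    (hL : Computable L) (hz : Computable z) (ht : Computable t) :
    Computable fun a => admissible R b (L a) (z a) (t a) := by
  have hentry : Computable fun q : α × ℕ => ((L q.1)[q.2]?).getD (0, b) :=
    Computable.option_getD (Computable.list_getElem?.comp (hL.comp Computable.fst) Computable.snd)
      (Computable.const (0, b))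
  have hsame : Computable fun q : α × ℕ => (((L q.1)[q.2]?).getD (0, b)).2 == b :=
    (Primrec.dom_bool (fun a => a == b)).to_comp.comp (Computable.snd.comp hentry)
  have hRt : Computable₂ fun (q : α × ℕ) (s : ℕ) =>
      R (z q.1) (((L q.1)[q.2]?).getD (0, b)).1 s :=
    hR.comp (Computable.pair (hz.comp (Computable.fst.comp Computable.fst))
      (Computable.pair (Computable.fst.comp (hentry.comp Computable.fst)) Computable.snd))
  exact Computable.allLt (Computable.list_length.comp hL) (Primrec.or.to_comp.comp hsame
    (Primrec.not.to_comp.comp (Computable.allLt (ht.comp Computable.fst) hRt))).to₂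

theorem partrec_extendColoring (hR : Computable fun p : ℕ × ℕ × ℕ => R p.1 p.2.1 p.2.2) :
    Partrec₂ (extendColoring R) := by
  have hadm (b : Bool) : Computable fun q : (List (ℕ × Bool) × ℕ) × ℕ =>
      admissible R b q.1.1 q.1.2 q.2 :=
    computable_admissible hR b (Computable.fst.comp Computable.fst)
      (Computable.snd.comp Computable.fst) Computable.snd
  have htest : Computable₂ fun (q : List (ℕ × Bool) × ℕ) (t : ℕ) =>
      admissible R true q.1 q.2 t || admissible R false q.1 q.2 t :=
    Primrec.or.to_comp.comp (hadm true) (hadm false)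
  have hcons : Computable₂ fun (q : List (ℕ × Bool) × ℕ) (t : ℕ) =>
      (q.2, admissible R true q.1 q.2 t) :: q.1 :=
    Computable.list_cons.comp
      (Computable.pair (Computable.snd.comp Computable.fst) (hadm true))
      (Computable.fst.comp Computable.fst)
  exact Partrec.map (Partrec.rfind htest.partrec₂) hcons

theorem computable_seedColoring (hR : Computable fun p : ℕ × ℕ × ℕ => R p.1 p.2.1 p.2.2) :
    Computable (seedColoring R) := by
  have hx : Computable fun c : ℕ => c.unpair.1 := Computable.fst.comp Computable.unpair
  have hp : Computable fun c : ℕ => c.unpair.2.unpair :=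
    Computable.unpair.comp (Computable.snd.comp Computable.unpair)
  have hy : Computable fun c : ℕ => c.unpair.2.unpair.1 := Computable.fst.comp hp
  refine Computable.cond (hR.comp (Computable.pair hx hp)) (Computable.const []) ?_
  exact Computable.list_cons.comp (Computable.pair hx (Computable.const true))
    (Computable.list_cons.comp (Computable.pair hy (Computable.const false)) (Computable.const []))

theorem partrec_coloring (hR : Computable fun p : ℕ × ℕ × ℕ => R p.1 p.2.1 p.2.2) :
    Partrec₂ (coloring R) :=
  Partrec.nat_rec (h := fun _ q => extendColoring R q.2 q.1) Computable.snd
    ((computable_seedColoring hR).comp Computable.fst).partrec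
    ((partrec_extendColoring hR).comp (Computable.snd.comp Computable.snd)
      (Computable.fst.comp Computable.snd))

/-- Entries of `L` with distinct colors are not `E`-related. -/
def SeparatesColors (E : ℕ → ℕ → Prop) (L : List (ℕ × Bool)) : Prop :=
  ∀ p ∈ L, ∀ q ∈ L, p.2 ≠ q.2 → ¬ E p.1 q.1

variable {E : ℕ → ℕ → Prop}

theorem exists_admissible (hRE : ∀ x y, E x y ↔ ∀ t, R x y t = true) {b : Bool}
    {L : List (ℕ × Bool)} {z : ℕ} (h : ∀ p ∈ L, p.2 = b ∨ ¬ E z p.1) :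
    ∃ t, admissible R b L z t = true := by
  have key : ∀ᶠ t in Filter.atTop, ∀ p ∈ L.toFinset, p.2 = b ∨ ∃ s < t, R z p.1 s = false := by
    rw [Filter.eventually_all_finset]
    intro p hp
    rcases h p (List.mem_toFinset.1 hp) with hb | hE
    · exact Filter.Eventually.of_forall fun _ => Or.inl hb
    · rw [hRE, not_forall] at hE
      obtain ⟨s, hs⟩ := hE
      filter_upwards [Filter.eventually_gt_atTop s] with t ht
      exact Or.inr ⟨s, ht, by simpa using hs⟩
  obtain ⟨t, ht⟩ := key.exists
  exact ⟨t, admissible_eq_true.2 fun p hp => ht p (List.mem_toFinset.2 hp)⟩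

theorem SeparatesColors.cons (hRE : ∀ x y, E x y ↔ ∀ t, R x y t = true)
    (hE : Equivalence E) {b : Bool} {L : List (ℕ × Bool)} {z t : ℕ}
    (hL : SeparatesColors E L) (h : admissible R b L z t = true) :
    SeparatesColors E ((z, b) :: L) := by
  have hz : ∀ p ∈ L, p.2 ≠ b → ¬ E z p.1 := by
    intro p hp hb hzp
    obtain ⟨s, -, hs⟩ := (admissible_eq_true.1 h p hp).resolve_left hb
    simp [(hRE _ _).1 hzp s] at hs
  intro p hp q hq hpq
  rcases List.mem_cons.1 hp with rfl | hp <;> rcases List.mem_cons.1 hq with rfl | hq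
  · exact absurd rfl hpq
  · exact hz q hq hpq.symm
  · exact fun h => hz p hp hpq (hE.symm h)
  · exact hL p hp q hq hpq

theorem exists_mem_extendColoring (hRE : ∀ x y, E x y ↔ ∀ t, R x y t = true)
    (hE : Equivalence E) {L : List (ℕ × Bool)} (hL : SeparatesColors E L) (z : ℕ) :
    ∃ b, (z, b) :: L ∈ extendColoring R L z ∧ SeparatesColors E ((z, b) :: L) := by
  have hex : ∃ t, (admissible R true L z t || admissible R false L z t) = true := by
    by_cases h : ∀ p ∈ L, p.2 = true ∨ ¬ E z p.1
    · obtain ⟨t, ht⟩ := exists_admissible hRE h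
      exact ⟨t, by simp [ht]⟩
    · push Not at h
      obtain ⟨p, hp, hpt, hzp⟩ := h
      obtain ⟨t, ht⟩ := exists_admissible (b := false) (z := z) hRE fun q hq => by
        by_cases hqf : q.2 = false
        · exact Or.inl hqf
        · refine Or.inr fun hzq => hL p hp q hq ?_ (hE.trans (hE.symm hzp) hzq)
          simp_all
      exact ⟨t, by simp [ht]⟩
  obtain ⟨m, hm⟩ := hex
  obtain ⟨t, ht, -⟩ := Nat.rfind_min'
    (p := fun t => admissible R true L z t || admissible R false L z t) hm
  refine ⟨admissible R true L z t, Part.mem_map _ ht, ?_⟩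
  have hspec : (admissible R true L z t || admissible R false L z t) = true := by
    simpa using Nat.rfind_spec ht
  refine hL.cons (t := t) hRE hE ?_
  cases h : admissible R true L z t <;> simp_all

theorem separatesColors_seedColoring (hRE : ∀ x y, E x y ↔ ∀ t, R x y t = true)
    (hE : Equivalence E) (c : ℕ) : SeparatesColors E (seedColoring R c) := by
  unfold seedColoring
  cases h : R c.unpair.1 c.unpair.2.unpair.1 c.unpair.2.unpair.2 with
  | true => simp [SeparatesColors]
  | false =>
    have hxy : ¬ E c.unpair.1 c.unpair.2.unpair.1 := fun hxy => by
      simp [(hRE _ _).1 hxy] at h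
    have hyx : ¬ E c.unpair.2.unpair.1 c.unpair.1 := fun hyx => hxy (hE.symm hyx)
    simp [SeparatesColors, hxy, hyx]

theorem exists_mem_coloring (hRE : ∀ x y, E x y ↔ ∀ t, R x y t = true)
    (hE : Equivalence E) (c n : ℕ) : ∃ L ∈ coloring R c n, SeparatesColors E L := by
  induction n with
  | zero => exact ⟨_, Part.mem_some _, separatesColors_seedColoring hRE hE c⟩
  | succ n ih =>
    obtain ⟨L, hL, hsep⟩ := ih
    obtain ⟨b, hb, hsep'⟩ := exists_mem_extendColoring hRE hE hsep n
    exact ⟨_, Part.mem_bind hL hb, hsep'⟩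

/-- A uniformly computable family of `E`-invariant two-colorings which separates points. -/
theorem exists_computable_separating_family
    (hR : Computable fun p : ℕ × ℕ × ℕ => R p.1 p.2.1 p.2.2)
    (hRE : ∀ x y, E x y ↔ ∀ t, R x y t = true) (hE : Equivalence E) :
    ∃ color : ℕ → ℕ → Bool, Computable₂ color ∧
      ∀ x y, E x y ↔ ∀ c, color c x = color c y := by
  choose l hl hsep using exists_mem_coloring hRE hE
  have hlc : Computable₂ l :=
    Partrec.of_eq_tot (partrec_coloring hR) fun q => hl q.1 q.2
  have hstep : ∀ c n, ∃ b, l c (n + 1) = (n, b) :: l c n := fun c n => by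
    obtain ⟨b, hb, -⟩ := exists_mem_extendColoring hRE hE (hsep c n) n
    exact ⟨b, Part.mem_unique (hl c (n + 1)) (Part.mem_bind (hl c n) hb)⟩
  choose color hcolor using hstep
  have hmono : ∀ c, Monotone fun n => {p | p ∈ l c n} := fun c =>
    monotone_nat_of_le_succ fun n p hp => by
      simp only [Set.mem_ofPred_eq, hcolor] at hp ⊢
      exact List.mem_cons_of_mem _ hp
  have hmem : ∀ c {m n}, m < n → (m, color c m) ∈ l c n := fun c m n h =>
    hmono c (Nat.succ_le_of_lt h) (by simp [hcolor])
  have hseed : ∀ c, l c 0 = seedColoring R c := fun c => Part.mem_some_iff.1 (hl c 0)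
  refine ⟨color, ?_, fun x y => ⟨fun hxy c => ?_, fun h => ?_⟩⟩
  · have hhead : Computable fun q : ℕ × ℕ => (l q.1 (q.2 + 1)).head? :=
      Primrec.list_head?.to_comp.comp
        (hlc.comp Computable.fst (Computable.succ.comp Computable.snd))
    refine (Computable.snd.comp
      (Computable.option_getD hhead (Computable.const (0, false)))).of_eq fun q => ?_
    simp [hcolor]
  · by_contra hne
    exact hsep c (max x y + 1) _ (hmem c (by omega)) _ (hmem c (by omega)) hne hxy
  · by_contra hxy
    rw [hRE, not_forall] at hxy
    obtain ⟨t, ht⟩ := hxy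
    set c := Nat.pair x (Nat.pair y t)
    have hc : l c 0 = [(x, true), (y, false)] := by
      rw [hseed]
      simp [seedColoring, c, ht]
    have hold : ∀ z b, (z, b) ∈ l c 0 → color c z = b := fun z b hz => by
      by_contra hne
      exact hsep c (z + 1) _ (hmem c z.lt_succ_self) _ (hmono c (Nat.zero_le _) hz) hne
        (hE.refl z)
    have hx : color c x = true := hold x true (by simp [hc])
    have hy : color c y = false := hold y false (by simp [hc])
    simpa [hx, hy] using h c

end Coloring

/-- Every Π⁰₁ equivalence relation is a uniform decreasing intersection of
computable equivalence relations. -/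
theorem stmt_4 (E : ℕ → ℕ → Prop) (hE : Pi01Rel E) (hEquiv : Equivalence E) :
    ∃ H : ℕ → ℕ → ℕ → Bool,
      Computable (fun p : ℕ × ℕ × ℕ => H p.1 p.2.1 p.2.2) ∧
      (∀ n, Equivalence (fun x y => H n x y = true)) ∧
      (∀ n x y, H (n + 1) x y = true → H n x y = true) ∧
      (∀ x y, E x y ↔ ∀ n, H n x y = true) := by
  obtain ⟨R, hR, hRE⟩ := hE
  obtain ⟨color, hcolor, hE'⟩ := exists_computable_separating_family hR hRE hEquiv
  refine ⟨fun n x y => allLt n fun c => color c x == color c y, ?_, fun n => ?_,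
    fun n x y h => ?_, fun x y => ?_⟩
  · exact Computable.allLt Computable.fst
      ((Primrec.dom_bool₂ (fun a b => a == b)).to_comp.comp
        (hcolor.comp Computable.snd (Computable.fst.comp (Computable.snd.comp Computable.fst)))
        (hcolor.comp Computable.snd (Computable.snd.comp (Computable.snd.comp Computable.fst))))
  · simp only [allLt_eq_true, beq_iff_eq]
    exact ⟨fun _ _ _ => rfl, fun h c hc => (h c hc).symm,
      fun h h' c hc => (h c hc).trans (h' c hc)⟩
  · simp only [allLt_eq_true] at h ⊢
    exact fun c hc => h c (Nat.lt_succ_of_lt hc)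
  · simp only [allLt_eq_true, beq_iff_eq, hE']
    exact ⟨fun h _ c _ => h c, fun h c => h (c + 1) c c.lt_succ_self⟩
end

section
/- For every Π⁰₂ equivalence relation E on ℕ there is a limit computable (Δ⁰₂) equivalence relation L on ℕ such that L is not computably reducible to E: no total computable function f : ℕ → ℕ satisfies L x y ↔ E (f x) (f y) for all x, y. -/
/-- `E` is computably reducible to `F`. -/
def ComputablyReducible (E F : ℕ → ℕ → Prop) : Prop :=
  ∃ f : ℕ → ℕ, Computable f ∧ ∀ x y, E x y ↔ F (f x) (f y)

/-- A binary relation on ℕ is Π⁰₂. -/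
def Pi02Rel (E : ℕ → ℕ → Prop) : Prop :=
  ∃ R : ℕ → ℕ → ℕ → ℕ → Bool,
    Computable (fun p : ℕ × ℕ × ℕ × ℕ => R p.1 p.2.1 p.2.2.1 p.2.2.2) ∧
    ∀ x y, E x y ↔ ∀ s, ∃ t, R x y s t = true

/-- A binary relation on ℕ is limit computable (Δ⁰₂). -/
def LimitComputableRel (L : ℕ → ℕ → Prop) : Prop :=
  ∃ h : ℕ → ℕ → ℕ → Bool,
    Computable (fun p : ℕ × ℕ × ℕ => h p.1 p.2.1 p.2.2) ∧
    ∀ x y, ∃ s₀, ∀ s ≥ s₀, (h x y s = true ↔ L x y)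

open Filter Nat.Partrec

/-- Whether `R x y s t` fails for all `t < k`. -/
def unrefuted (R : ℕ → ℕ → ℕ → ℕ → Bool) (x y s k : ℕ) : Bool :=
  Nat.rec true (fun t acc => acc && !R x y s t) k

theorem unrefuted_eq_true {R : ℕ → ℕ → ℕ → ℕ → Bool} {x y s k : ℕ} :
    unrefuted R x y s k = true ↔ ∀ t < k, R x y s t = false := by
  induction k with
  | zero => simp [unrefuted]
  | succ k ih =>
    have h : unrefuted R x y s (k + 1) = (unrefuted R x y s k && !R x y s k) := rfl
    rw [h, Bool.and_eq_true, ih, Nat.forall_lt_succ_right]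
    simp

theorem eventually_unrefuted (R : ℕ → ℕ → ℕ → ℕ → Bool) (x y s : ℕ) :
    ∀ᶠ k in atTop, (unrefuted R x y s k = true ↔ ∀ t, R x y s t = false) := by
  by_cases h : ∀ t, R x y s t = false
  · exact Eventually.of_forall fun k => by simp [unrefuted_eq_true, h]
  · obtain ⟨t, ht⟩ := not_forall.1 h
    filter_upwards [eventually_gt_atTop t] with k hk
    rw [unrefuted_eq_true]
    exact ⟨fun H => absurd (H t hk) ht, fun H => absurd H h⟩

theorem computable_unrefuted {R : ℕ → ℕ → ℕ → ℕ → Bool}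
    (hR : Computable fun p : ℕ × ℕ × ℕ × ℕ => R p.1 p.2.1 p.2.2.1 p.2.2.2)
    {α : Type*} [Primcodable α] {x y s k : α → ℕ} (hx : Computable x) (hy : Computable y)
    (hs : Computable s) (hk : Computable k) :
    Computable fun a => unrefuted R (x a) (y a) (s a) (k a) := by
  have hR' : Computable fun q : α × ℕ × Bool => R (x q.1) (y q.1) (s q.1) q.2.1 :=
    hR.comp ((hx.comp .fst).pair ((hy.comp .fst).pair
      ((hs.comp .fst).pair (Computable.fst.comp .snd))))
  exact Computable.nat_rec hk (.const true)
    (Primrec.and.to_comp.comp (Computable.snd.comp .snd) (Primrec.not.to_comp.comp hR')).to₂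

/-- The least `m < k` satisfying `q`, or `k` if there is none. -/
def boundedSearch (q : ℕ → Bool) (k : ℕ) : ℕ :=
  Nat.rec 0 (fun _ m => cond (q m) m (m + 1)) k

theorem boundedSearch_eq {q : ℕ → Bool} {m k : ℕ} (hm : q m = true)
    (hlt : ∀ i < m, q i = false) (hk : m ≤ k) : boundedSearch q k = m := by
  have hstep (j : ℕ) : boundedSearch q (j + 1) =
      cond (q (boundedSearch q j)) (boundedSearch q j) (boundedSearch q j + 1) := rfl
  have hle : ∀ j ≤ m, boundedSearch q j = j := by
    intro j
    induction j with
    | zero => exact fun _ => rfl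
    | succ j ih =>
      intro hj
      rw [hstep, ih (by omega), hlt j (by omega), cond_false]
  induction k, hk using Nat.le_induction with
  | base => exact hle m le_rfl
  | succ k _ ih => rw [hstep, ih, hm, cond_true]

/-- The stage `k` guess at a side of the pair `u, v` from which `w` is separated: `true` stands
for `u` and `false` for `v`. -/
def separatedSide (R : ℕ → ℕ → ℕ → ℕ → Bool) (w u v k : ℕ) : Bool :=
  unrefuted R w u (boundedSearch (fun m => unrefuted R w u m k || unrefuted R w v m k) k) k

theorem computable_separatedSide {R : ℕ → ℕ → ℕ → ℕ → Bool}
    (hR : Computable fun p : ℕ × ℕ × ℕ × ℕ => R p.1 p.2.1 p.2.2.1 p.2.2.2)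
    {α : Type*} [Primcodable α] {w u v k : α → ℕ} (hw : Computable w) (hu : Computable u)
    (hv : Computable v) (hk : Computable k) :
    Computable fun a => separatedSide R (w a) (u a) (v a) (k a) := by
  have hm : Computable fun q : α × ℕ × ℕ => q.2.2 := Computable.snd.comp .snd
  refine computable_unrefuted hR hw hu ?_ hk
  exact Computable.nat_rec hk (.const 0) (Computable.cond
    (Primrec.or.to_comp.comp
      (computable_unrefuted hR (hw.comp .fst) (hu.comp .fst) hm (hk.comp .fst))
      (computable_unrefuted hR (hw.comp .fst) (hv.comp .fst) hm (hk.comp .fst)))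
    hm (Computable.succ.comp hm)).to₂

theorem exists_eventually_separatedSide (R : ℕ → ℕ → ℕ → ℕ → Bool) {w u v : ℕ}
    (h : ∃ s, (∀ t, R w u s t = false) ∨ ∀ t, R w v s t = false) :
    ∃ side : Bool, (∀ᶠ k in atTop, separatedSide R w u v k = side) ∧
      ∃ s, ∀ t, R w (cond side u v) s t = false := by
  classical
  obtain ⟨m, hm, hmin⟩ : ∃ m, ((∀ t, R w u m t = false) ∨ ∀ t, R w v m t = false) ∧
      ∀ i < m, ¬((∀ t, R w u i t = false) ∨ ∀ t, R w v i t = false) :=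
    ⟨Nat.find h, Nat.find_spec h, fun _ => Nat.find_min h⟩
  have hsearch : ∀ᶠ k in atTop,
      boundedSearch (fun m => unrefuted R w u m k || unrefuted R w v m k) k = m := by
    have hall : ∀ᶠ k in atTop, ∀ i ∈ Set.Iic m,
        (unrefuted R w u i k = true ↔ ∀ t, R w u i t = false) ∧
        (unrefuted R w v i k = true ↔ ∀ t, R w v i t = false) :=
      (Set.finite_Iic m).eventually_all.2 fun i _ =>
        (eventually_unrefuted R w u i).and (eventually_unrefuted R w v i)
    filter_upwards [hall, eventually_ge_atTop m] with k hk hmk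
    refine boundedSearch_eq ?_ (fun i hi => ?_) hmk
    · rw [Bool.or_eq_true, (hk m Set.self_mem_Iic).1, (hk m Set.self_mem_Iic).2]
      exact hm
    · rw [← Bool.not_eq_true, Bool.or_eq_true, (hk i hi.le).1, (hk i hi.le).2]
      exact hmin i hi
  refine ⟨decide (∀ t, R w u m t = false), ?_, m, ?_⟩
  · filter_upwards [hsearch, eventually_unrefuted R w u m] with k hk hu
    rw [separatedSide, hk, Bool.eq_iff_iff, hu, decide_eq_true_iff]
  · by_cases hu : ∀ t, R w u m t = false
    · simp [hu]
    · simpa only [hu, decide_false, cond_false] using hm.resolve_left hu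

/-- The stage `k` guess at the representative of `x`, given the values `u`, `v`, `w` of the
function to be diagonalized against at the two base points of the column of `x` and at `x`. -/
def mergeStage (R : ℕ → ℕ → ℕ → ℕ → Bool) (x u v w k : ℕ) : ℕ :=
  cond (decide (2 ≤ x.unpair.2) && unrefuted R u v (x.unpair.2 - 2) k)
    (Nat.pair x.unpair.1 (cond (separatedSide R w u v k) 0 1)) x

/-- The stage `k` guess at the representative of `x`. The points `Nat.pair e i` form the column
devoted to the `e`-th partial computable function; its base points are those with `i < 2`. -/
def repStage (R : ℕ → ℕ → ℕ → ℕ → Bool) (x k : ℕ) : ℕ :=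
  ((Code.evaln k (Denumerable.ofNat Code x.unpair.1) (Nat.pair x.unpair.1 0)).bind fun u =>
    (Code.evaln k (Denumerable.ofNat Code x.unpair.1) (Nat.pair x.unpair.1 1)).bind fun v =>
      (Code.evaln k (Denumerable.ofNat Code x.unpair.1) x).map fun w =>
        mergeStage R x u v w k).getD x

theorem computable_repStage {R : ℕ → ℕ → ℕ → ℕ → Bool}
    (hR : Computable fun p : ℕ × ℕ × ℕ × ℕ => R p.1 p.2.1 p.2.2.1 p.2.2.2) :
    Computable₂ (repStage R) := by
  have hcol {α : Type} [Primcodable α] {x : α → ℕ} (hx : Computable x) :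
      Computable fun a => (x a).unpair.1 :=
    Computable.fst.comp (Computable.unpair.comp hx)
  have hrow {α : Type} [Primcodable α] {x : α → ℕ} (hx : Computable x) :
      Computable fun a => (x a).unpair.2 :=
    Computable.snd.comp (Computable.unpair.comp hx)
  have hpair {α : Type} [Primcodable α] {x y : α → ℕ} (hx : Computable x) (hy : Computable y) :
      Computable fun a => Nat.pair (x a) (y a) :=
    Primrec₂.natPair.to_comp.comp hx hy
  have hev {α : Type} [Primcodable α] {k x y : α → ℕ} (hk : Computable k) (hx : Computable x)
      (hy : Computable y) : Computable fun a =>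
        Code.evaln (k a) (Denumerable.ofNat Code (x a).unpair.1) (y a) :=
    Code.primrec_evaln.to_comp.comp
      ((hk.pair ((Computable.ofNat Code).comp (hcol hx))).pair hy)
  have hmerge {α : Type} [Primcodable α] {x u v w k : α → ℕ} (hx : Computable x)
      (hu : Computable u) (hv : Computable v) (hw : Computable w) (hk : Computable k) :
      Computable fun a => mergeStage R (x a) (u a) (v a) (w a) (k a) := by
    refine Computable.cond (Primrec.and.to_comp.comp ?_ ?_) ?_ hx
    · exact (Primrec.nat_le.decide.to_comp).comp (.const 2) (hrow hx)
    · exact computable_unrefuted hR hu hv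
        (Primrec.nat_sub.to_comp.comp (hrow hx) (.const 2)) hk
    · exact hpair (hcol hx) (Computable.cond (computable_separatedSide hR hw hu hv hk)
        (.const 0) (.const 1))
  refine Computable.option_getD ?_ .fst
  refine Computable.option_bind
    (hev .snd .fst (hpair (hcol .fst) (.const 0))) ?_
  unfold Computable₂
  have h1 : Computable fun q : (ℕ × ℕ) × ℕ => q.1.1 := Computable.fst.comp .fst
  have h2 : Computable fun q : (ℕ × ℕ) × ℕ => q.1.2 := Computable.snd.comp .fst
  refine Computable.option_bind (hev h2 h1 (hpair (hcol h1) (.const 1))) ?_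
  unfold Computable₂
  refine Computable.option_map (hev (h2.comp .fst) (h1.comp .fst) (h1.comp .fst)) ?_
  unfold Computable₂
  have h : Computable fun q : (((ℕ × ℕ) × ℕ) × ℕ) × ℕ => q.1.1 := Computable.fst.comp .fst
  exact hmerge (h1.comp h) (Computable.snd.comp h) (Computable.snd.comp .fst) .snd (h2.comp h)

theorem repStage_of_lt_two (R : ℕ → ℕ → ℕ → ℕ → Bool) {e i : ℕ} (hi : i < 2) (k : ℕ) :
    repStage R (Nat.pair e i) k = Nat.pair e i := by
  have (u v w : ℕ) : mergeStage R (Nat.pair e i) u v w k = Nat.pair e i := by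
    simp [mergeStage, hi.not_ge]
  simp only [repStage, this]
  cases Code.evaln k (Denumerable.ofNat Code (Nat.pair e i).unpair.1)
    (Nat.pair (Nat.pair e i).unpair.1 0) <;>
  cases Code.evaln k (Denumerable.ofNat Code (Nat.pair e i).unpair.1)
    (Nat.pair (Nat.pair e i).unpair.1 1) <;>
  cases Code.evaln k (Denumerable.ofNat Code (Nat.pair e i).unpair.1) (Nat.pair e i) <;> rfl

theorem eventually_evaln_eq_some {c : Code} {n x : ℕ} (h : x ∈ c.eval n) :
    ∀ᶠ k in atTop, c.evaln k n = some x := by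
  obtain ⟨k₀, hk₀⟩ := Code.evaln_complete.1 h
  filter_upwards [eventually_ge_atTop k₀] with k hk
  exact Code.evaln_mono hk hk₀

theorem exists_eventually_evaln (c : Code) (n : ℕ) :
    ∃ o : Option ℕ, ∀ᶠ k in atTop, c.evaln k n = o := by
  by_cases h : (c.eval n).Dom
  · exact ⟨_, eventually_evaln_eq_some (Part.get_mem h)⟩
  · refine ⟨none, Eventually.of_forall fun k => Option.eq_none_iff_forall_not_mem.2 fun x hx => ?_⟩
    exact h (Part.dom_iff_mem.2 ⟨x, Code.evaln_sound hx⟩)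

theorem exists_eventually_mergeStage {E : ℕ → ℕ → Prop} (hE : Equivalence E)
    {R : ℕ → ℕ → ℕ → ℕ → Bool} (hR : ∀ x y, E x y ↔ ∀ s, ∃ t, R x y s t = true)
    (x u v w : ℕ) :
    ∃ r, (∀ᶠ k in atTop, mergeStage R x u v w k = r) ∧
      (2 ≤ x.unpair.2 → (∀ t, R u v (x.unpair.2 - 2) t = false) →
        ∃ side : Bool, r = Nat.pair x.unpair.1 (cond side 0 1) ∧ ¬E w (cond side u v)) := by
  have hnot (y z : ℕ) : ¬E y z ↔ ∃ s, ∀ t, R y z s t = false := by simp [hR]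
  by_cases h : 2 ≤ x.unpair.2 ∧ ∀ t, R u v (x.unpair.2 - 2) t = false
  · have huv : ¬E u v := (hnot u v).2 ⟨_, h.2⟩
    have hw : ¬E w u ∨ ¬E w v := by
      by_contra! H
      exact huv (hE.trans (hE.symm H.1) H.2)
    rw [hnot, hnot, ← exists_or] at hw
    obtain ⟨side, hside, hsep⟩ := exists_eventually_separatedSide R hw
    refine ⟨_, ?_, fun _ _ => ⟨side, rfl, (hnot _ _).2 hsep⟩⟩
    filter_upwards [hside, eventually_unrefuted R u v (x.unpair.2 - 2)] with k hk hu
    rw [mergeStage, hk, hu.2 h.2, decide_eq_true h.1, Bool.and_self, cond_true]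
  · refine ⟨x, ?_, fun h₁ h₂ => absurd ⟨h₁, h₂⟩ h⟩
    filter_upwards [eventually_unrefuted R u v (x.unpair.2 - 2)] with k hu
    have : (decide (2 ≤ x.unpair.2) && unrefuted R u v (x.unpair.2 - 2) k) = false := by
      rwa [← Bool.not_eq_true, Bool.and_eq_true, decide_eq_true_iff, hu]
    rw [mergeStage, this, cond_false]

theorem exists_eventually_repStage {E : ℕ → ℕ → Prop} (hE : Equivalence E)
    {R : ℕ → ℕ → ℕ → ℕ → Bool} (hR : ∀ x y, E x y ↔ ∀ s, ∃ t, R x y s t = true) (x : ℕ) :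
    ∃ r, ∀ᶠ k in atTop, repStage R x k = r := by
  have hev := exists_eventually_evaln (Denumerable.ofNat Code x.unpair.1)
  obtain ⟨ou, hu⟩ := hev (Nat.pair x.unpair.1 0)
  obtain ⟨ov, hv⟩ := hev (Nat.pair x.unpair.1 1)
  obtain ⟨ow, hw⟩ := hev x
  choose m hm _ using exists_eventually_mergeStage hE hR x
  refine ⟨(ou.bind fun u => ov.bind fun v => ow.map fun w => m u v w).getD x, ?_⟩
  have hm' : ∀ᶠ k in atTop, ∀ u ∈ ou, ∀ v ∈ ov, ∀ w ∈ ow, mergeStage R x u v w k = m u v w := by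
    rcases ou with _ | u <;> rcases ov with _ | v <;> rcases ow with _ | w <;>
      simp [hm]
  filter_upwards [hu, hv, hw, hm'] with k hu hv hw hm
  rw [repStage, hu, hv, hw]
  rcases ou with _ | u <;> rcases ov with _ | v <;> rcases ow with _ | w <;>
    simp_all

/-- For every Π⁰₂ equivalence relation there is a Δ⁰₂ equivalence relation not
computably reducible to it. -/
theorem stmt_6 (E : ℕ → ℕ → Prop) (hE : Pi02Rel E) (hEquiv : Equivalence E) :
    ∃ L : ℕ → ℕ → Prop, LimitComputableRel L ∧ Equivalence L ∧
      ¬ ComputablyReducible L E := by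
  obtain ⟨R, hRc, hR⟩ := hE
  choose rep hrep using exists_eventually_repStage hEquiv hR
  refine ⟨fun x y => rep x = rep y, ⟨fun x y k => decide (repStage R x k = repStage R y k), ?_,
    fun x y => ?_⟩, ⟨fun _ => rfl, Eq.symm, Eq.trans⟩, ?_⟩
  · have hc := computable_repStage hRc
    exact Primrec.eq.decide.to_comp.comp (hc.comp .fst (Computable.snd.comp .snd))
      (hc.comp (Computable.fst.comp .snd) (Computable.snd.comp .snd))
  · refine eventually_atTop.1 ?_
    filter_upwards [hrep x, hrep y] with k hx hy
    rw [decide_eq_true_iff, hx, hy]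
  · rintro ⟨f, hf, hred⟩
    beta_reduce at hred
    obtain ⟨c, hc⟩ := Code.exists_code.1 (Partrec.nat_iff.1 hf.partrec)
    obtain ⟨e, rfl⟩ : ∃ e, Denumerable.ofNat Code e = c := ⟨_, Denumerable.ofNat_encode c⟩
    have hbase {i : ℕ} (hi : i < 2) : rep (Nat.pair e i) = Nat.pair e i := by
      obtain ⟨k, hk⟩ := (hrep (Nat.pair e i)).exists
      rw [← hk, repStage_of_lt_two R hi]
    have hsep : ¬E (f (Nat.pair e 0)) (f (Nat.pair e 1)) := by
      rw [← hred, hbase two_pos, hbase one_lt_two, Nat.pair_eq_pair]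
      simp
    obtain ⟨n, hn⟩ : ∃ s, ∀ t, R (f (Nat.pair e 0)) (f (Nat.pair e 1)) s t = false := by
      simpa [hR] using hsep
    set x := Nat.pair e (n + 2) with hx
    have hx₁ : x.unpair.1 = e := by simp [hx]
    have hx₂ : x.unpair.2 = n + 2 := by simp [hx]
    obtain ⟨r, hr, hmerge⟩ := exists_eventually_mergeStage hEquiv hR x
      (f (Nat.pair e 0)) (f (Nat.pair e 1)) (f x)
    rw [hx₁, hx₂] at hmerge
    obtain ⟨side, hside, hne⟩ := hmerge (by omega) (by simpa using hn)
    have hval (i : ℕ) : ∀ᶠ k in atTop,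
        (Denumerable.ofNat Code e).evaln k i = some (f i) :=
      eventually_evaln_eq_some (by simp [hc])
    have hrx : rep x = r := by
      obtain ⟨k, h₁, h₂, h₃, h₄, h₅⟩ := ((hrep x).and ((hval (Nat.pair e 0)).and
        ((hval (Nat.pair e 1)).and ((hval x).and hr)))).exists
      rw [← h₁, repStage, hx₁, h₂, h₃, h₄]
      exact h₅
    have hlt : cond side 0 1 < 2 := by cases side <;> decide
    have hE' : E (f x) (f (Nat.pair e (cond side 0 1))) := by
      rw [← hred, hrx, hside, hbase hlt]
    cases side <;> exact hne hE'
end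

section
/- There is no Π⁰₂ preorder P on ℕ such that every Π⁰₂ preorder on ℕ is computably reducible to P; there is no limit computable (Δ⁰₂) equivalence relation E on ℕ such that every limit computable equivalence relation is computably reducible to E; and there is no limit computable preorder P on ℕ such that every limit computable preorder is computably reducible to P. -/
open Filter
open Nat.Partrec (Code)

/-- One step of the search for witnesses of `∀ s, ∃ t, r s t`: the state `(s, t)` records that
witnesses have been found below `s` and that `t` is the next candidate for `s`. -/
def witnessStep (r : ℕ → ℕ → Bool) (p : ℕ × ℕ) : ℕ × ℕ :=
  bif r p.1 p.2 then (p.1 + 1, 0) else (p.1, p.2 + 1)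

/-- The number of consecutive `s` for which a witness has been found after `u` steps. -/
def witnessCount (r : ℕ → ℕ → Bool) (u : ℕ) : ℕ :=
  (Nat.rec (0, 0) (fun _ p => witnessStep r p) u : ℕ × ℕ).1

theorem witnessCount_monotone (r : ℕ → ℕ → Bool) : Monotone (witnessCount r) := by
  refine monotone_nat_of_le_succ fun u => ?_
  simp only [witnessCount]
  generalize (Nat.rec (0, 0) (fun _ p => witnessStep r p) u : ℕ × ℕ) = p
  unfold witnessStep
  cases r p.1 p.2 <;> simp

/-- If `s` has a witness, then a search that reaches the state `(s, 0)` also reaches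
`(s + 1, 0)`. -/
theorem witnessStep_reaches (r : ℕ → ℕ → Bool) {s : ℕ} (hs : ∃ t, r s t = true) (u : ℕ)
    (hu : (Nat.rec (0, 0) (fun _ p => witnessStep r p) u : ℕ × ℕ) = (s, 0)) :
    ∃ v, (Nat.rec (0, 0) (fun _ p => witnessStep r p) v : ℕ × ℕ) = (s + 1, 0) := by
  classical
  have stay : ∀ j, j ≤ Nat.find hs →
      (Nat.rec (0, 0) (fun _ p => witnessStep r p) (u + j) : ℕ × ℕ) = (s, j) := by
    intro j
    induction j with
    | zero => intro _; exact hu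
    | succ j ih =>
      intro hj
      have hr : r s j = false := by simpa using Nat.find_min hs (Nat.lt_of_succ_le hj)
      change witnessStep r (Nat.rec (0, 0) (fun _ p => witnessStep r p) (u + j) : ℕ × ℕ) = _
      rw [ih (by omega)]
      simp [witnessStep, hr]
  refine ⟨u + Nat.find hs + 1, ?_⟩
  change witnessStep r
    (Nat.rec (0, 0) (fun _ p => witnessStep r p) (u + Nat.find hs) : ℕ × ℕ) = _
  rw [stay _ le_rfl]
  simp [witnessStep, Nat.find_spec hs]

theorem witnessCount_tendsto (r : ℕ → ℕ → Bool) (h : ∀ s, ∃ t, r s t = true) :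
    Tendsto (witnessCount r) atTop atTop := by
  refine tendsto_atTop_atTop_of_monotone (witnessCount_monotone r) fun s => ?_
  have key : ∃ u, (Nat.rec (0, 0) (fun _ p => witnessStep r p) u : ℕ × ℕ) = (s, 0) := by
    induction s with
    | zero => exact ⟨0, rfl⟩
    | succ s ih => exact ih.elim fun u hu => witnessStep_reaches r (h s) u hu
  obtain ⟨u, hu⟩ := key
  exact ⟨u, by simp [witnessCount, hu]⟩

theorem witnessCount_le (r : ℕ → ℕ → Bool) {s : ℕ} (h : ∀ t, r s t = false) (u : ℕ) :
    witnessCount r u ≤ s := by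
  induction u with
  | zero => exact Nat.zero_le _
  | succ u ih =>
    simp only [witnessCount] at ih ⊢
    generalize (Nat.rec (0, 0) (fun _ p => witnessStep r p) u : ℕ × ℕ) = p at ih
    obtain ⟨a, b⟩ := p
    rcases ih.lt_or_eq with hlt | rfl
    · unfold witnessStep
      cases r a b <;> simp at hlt ⊢ <;> omega
    · simp [witnessStep, h b]

theorem Monotone.eventually_eq_of_bounded {f : ℕ → ℕ} (hf : Monotone f) {b : ℕ}
    (hb : ∀ u, f u ≤ b) : ∃ n, ∀ᶠ u in atTop, f u = n := by
  have hbdd : BddAbove (Set.range f) := ⟨b, by rintro _ ⟨u, rfl⟩; exact hb u⟩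
  obtain ⟨v, hv⟩ := Nat.sSup_mem (Set.range_nonempty f) hbdd
  exact ⟨f v, (eventually_ge_atTop v).mono fun u hu =>
    le_antisymm (hv ▸ le_csSup hbdd ⟨u, rfl⟩) (hf hu)⟩

/-- A Π⁰₂ relation has a computable monotone counter that is unbounded on related pairs and
eventually constant on unrelated pairs. -/
theorem Pi02Rel.exists_counter {E : ℕ → ℕ → Prop} (hE : Pi02Rel E) :
    ∃ l : ℕ → ℕ → ℕ → ℕ, Computable (fun p : ℕ × ℕ × ℕ => l p.1 p.2.1 p.2.2) ∧
      (∀ x y, Monotone (l x y)) ∧ (∀ x y, E x y → Tendsto (l x y) atTop atTop) ∧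
      ∀ x y, ¬ E x y → ∃ n, ∀ᶠ u in atTop, l x y u = n := by
  obtain ⟨R, hR, hER⟩ := hE
  refine ⟨fun x y => witnessCount (R x y), ?_, fun x y => witnessCount_monotone _,
    fun x y h => witnessCount_tendsto _ ((hER x y).1 h), fun x y h => ?_⟩
  · have hstate : Computable fun q : (ℕ × ℕ × ℕ) × ℕ × (ℕ × ℕ) => q.2.2 :=
      Computable.snd.comp Computable.snd
    have hs := Computable.fst.comp hstate
    have ht := Computable.snd.comp hstate
    have hx : Computable fun q : (ℕ × ℕ × ℕ) × ℕ × (ℕ × ℕ) => q.1.1 :=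
      Computable.fst.comp Computable.fst
    have hy : Computable fun q : (ℕ × ℕ × ℕ) × ℕ × (ℕ × ℕ) => q.1.2.1 :=
      Computable.fst.comp (Computable.snd.comp Computable.fst)
    have hstep : Computable₂ fun (p : ℕ × ℕ × ℕ) (q : ℕ × (ℕ × ℕ)) =>
        witnessStep (R p.1 p.2.1) q.2 := by
      have hr := hR.comp (hx.pair (hy.pair (hs.pair ht)))
      exact Computable.cond hr ((Computable.succ.comp hs).pair (Computable.const 0))
        (hs.pair (Computable.succ.comp ht))
    have hu : Computable fun p : ℕ × ℕ × ℕ => p.2.2 := Computable.snd.comp Computable.snd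
    have hrec := Computable.nat_rec hu (Computable.const ((0, 0) : ℕ × ℕ)) hstep
    exact Computable.fst.comp hrec
  · rw [hER] at h
    push Not at h
    obtain ⟨s, hs⟩ := h
    exact (witnessCount_monotone _).eventually_eq_of_bounded
      (witnessCount_le _ fun t => by simpa using hs t)

theorem Pi02Rel.symmetric_part {P : ℕ → ℕ → Prop} (hP : Pi02Rel P) :
    Pi02Rel fun x y => P x y ∧ P y x := by
  obtain ⟨R, hR, hPR⟩ := hP
  refine ⟨fun x y s t => R x y s t.unpair.1 && R y x s t.unpair.2, ?_, fun x y => ?_⟩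
  · have hx : Computable fun p : ℕ × ℕ × ℕ × ℕ => p.1 := Computable.fst
    have hy : Computable fun p : ℕ × ℕ × ℕ × ℕ => p.2.1 := Computable.fst.comp Computable.snd
    have hs : Computable fun p : ℕ × ℕ × ℕ × ℕ => p.2.2.1 :=
      Computable.fst.comp (Computable.snd.comp Computable.snd)
    have ht : Computable fun p : ℕ × ℕ × ℕ × ℕ => p.2.2.2.unpair :=
      Computable.unpair.comp (Computable.snd.comp (Computable.snd.comp Computable.snd))
    have hxy := hR.comp (hx.pair (hy.pair (hs.pair (Computable.fst.comp ht))))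
    have hyx := hR.comp (hy.pair (hx.pair (hs.pair (Computable.snd.comp ht))))
    exact Primrec.and.to_comp.comp hxy hyx
  · simp only [hPR]
    rw [← forall_and]
    refine forall_congr' fun s => ⟨?_, ?_⟩
    · rintro ⟨⟨t, ht⟩, t', ht'⟩
      exact ⟨Nat.pair t t', by simp [ht, ht']⟩
    · rintro ⟨t, ht⟩
      rw [Bool.and_eq_true] at ht
      exact ⟨⟨_, ht.1⟩, _, ht.2⟩

theorem LimitComputableRel.pi02Rel {L : ℕ → ℕ → Prop} (hL : LimitComputableRel L) :
    Pi02Rel L := by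
  obtain ⟨h, hh, hlim⟩ := hL
  refine ⟨fun x y s t => h x y (s + t), ?_, fun x y => ?_⟩
  · have hx : Computable fun p : ℕ × ℕ × ℕ × ℕ => p.1 := Computable.fst
    have hy : Computable fun p : ℕ × ℕ × ℕ × ℕ => p.2.1 := Computable.fst.comp Computable.snd
    have hst : Computable fun p : ℕ × ℕ × ℕ × ℕ => p.2.2.1 + p.2.2.2 :=
      Primrec.nat_add.to_comp.comp (Computable.fst.comp (Computable.snd.comp Computable.snd))
        (Computable.snd.comp (Computable.snd.comp Computable.snd))
    have hxy := hh.comp (hx.pair (hy.pair hst))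
    exact hxy
  · obtain ⟨s₀, hs₀⟩ := hlim x y
    refine ⟨fun hl s => ⟨s₀, (hs₀ _ (by omega)).2 hl⟩, fun hl => ?_⟩
    obtain ⟨t, ht⟩ := hl s₀
    exact (hs₀ _ (by omega)).1 ht

theorem evaln_eventually_const (c : Code) (n : ℕ) :
    ∃ o : Option ℕ, ∀ᶠ u in atTop, Code.evaln u c n = o := by
  by_cases h : ∃ u a, Code.evaln u c n = some a
  · obtain ⟨u, a, ha⟩ := h
    exact ⟨some a, (eventually_ge_atTop u).mono fun v hv => Code.evaln_mono hv ha⟩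
  · push Not at h
    exact ⟨none, .of_forall fun u => Option.eq_none_iff_forall_ne_some.2 (h u)⟩

/-- The colour at stage `u` of an element with index `i` of a column, where `a₀`, `a₁`, `b` are
the images of the first two elements of the column and of the element itself. -/
def colourOfImages (l : ℕ → ℕ → ℕ → ℕ) (u i a₀ a₁ b : ℕ) : Bool :=
  decide (l a₀ a₁ u + 2 = i) && decide (l b a₁ u < l b a₀ u)

/-- The stage `u` approximation to the colouring that diagonalizes, in column `e`, against the
function with code `e`. The first two elements of a column get distinct colours. -/
def colour (l : ℕ → ℕ → ℕ → ℕ) (x u : ℕ) : Bool :=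
  bif x.unpair.2 == 1 then true else
    (((Code.evaln u (Denumerable.ofNat Code x.unpair.1) (Nat.pair x.unpair.1 0)).bind fun a₀ =>
      (Code.evaln u (Denumerable.ofNat Code x.unpair.1) (Nat.pair x.unpair.1 1)).bind fun a₁ =>
      (Code.evaln u (Denumerable.ofNat Code x.unpair.1) x).map fun b =>
        colourOfImages l u x.unpair.2 a₀ a₁ b).getD false)

theorem colour_computable {l : ℕ → ℕ → ℕ → ℕ}
    (hl : Computable fun p : ℕ × ℕ × ℕ => l p.1 p.2.1 p.2.2) : Computable₂ (colour l) := by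
  have hcol {α : Type} [Primcodable α] {x : α → ℕ} (hx : Computable x) :
      Computable fun p => (x p).unpair.1 := Computable.fst.comp (Computable.unpair.comp hx)
  have hidx {α : Type} [Primcodable α] {x : α → ℕ} (hx : Computable x) :
      Computable fun p => (x p).unpair.2 := Computable.snd.comp (Computable.unpair.comp hx)
  have heval {α : Type} [Primcodable α] {x u n : α → ℕ} (hx : Computable x)
      (hu : Computable u) (hn : Computable n) : Computable fun p =>
        Code.evaln (u p) (Denumerable.ofNat Code (x p).unpair.1) (n p) :=
    Code.primrec_evaln.to_comp.comp
      ((hu.pair ((Computable.ofNat Code).comp (hcol hx))).pair hn)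
  have hpair {α : Type} [Primcodable α] {x : α → ℕ} (hx : Computable x) (i : ℕ) :
      Computable fun p => Nat.pair (x p).unpair.1 i :=
    Primrec₂.natPair.to_comp.comp (hcol hx) (Computable.const i)
  have himg {α : Type} [Primcodable α] {u i a₀ a₁ b : α → ℕ} (hu : Computable u)
      (hi : Computable i) (h₀ : Computable a₀) (h₁ : Computable a₁) (hb : Computable b) :
      Computable fun p => colourOfImages l (u p) (i p) (a₀ p) (a₁ p) (b p) := by
    refine Primrec.and.to_comp.comp ?_ ?_
    · exact Primrec.eq.decide.to_comp.comp (Primrec.nat_add.to_comp.comp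
        (hl.comp (h₀.pair (h₁.pair hu))) (Computable.const 2)) hi
    · exact Primrec.nat_lt.decide.to_comp.comp (hl.comp (hb.pair (h₁.pair hu)))
        (hl.comp (hb.pair (h₀.pair hu)))
  have hx : Computable fun p : ℕ × ℕ => p.1 := Computable.fst
  have hu : Computable fun p : ℕ × ℕ => p.2 := Computable.snd
  refine Computable.cond (Primrec.beq.to_comp.comp (hidx hx) (Computable.const 1))
    (Computable.const true) (Computable.option_getD ?_ (Computable.const false))
  refine Computable.option_bind (heval hx hu (hpair hx 0)) ?_
  have hx₁ := hx.comp (Computable.fst (α := ℕ × ℕ) (β := ℕ))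
  have hu₁ := hu.comp (Computable.fst (α := ℕ × ℕ) (β := ℕ))
  refine Computable.option_bind (heval hx₁ hu₁ (hpair hx₁ 1)) ?_
  have hx₂ := hx₁.comp (Computable.fst (α := (ℕ × ℕ) × ℕ) (β := ℕ))
  have hu₂ := hu₁.comp (Computable.fst (α := (ℕ × ℕ) × ℕ) (β := ℕ))
  refine Computable.option_map (heval hx₂ hu₂ hx₂) ?_
  have hp := Computable.fst (α := ((ℕ × ℕ) × ℕ) × ℕ) (β := ℕ)
  exact himg (hu₂.comp hp) (hidx (hx₂.comp hp))
    (Computable.snd.comp (Computable.fst.comp hp)) (Computable.snd.comp hp) Computable.snd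

theorem decide_eventually_const_of_eventually {p : ℕ → Prop} [DecidablePred p]
    (h : (∀ᶠ u in atTop, p u) ∨ ∀ᶠ u in atTop, ¬ p u) :
    ∃ v, ∀ᶠ u in atTop, decide (p u) = v := by
  rcases h with h | h
  · exact ⟨true, h.mono fun u hu => by simpa using hu⟩
  · exact ⟨false, h.mono fun u hu => by simpa using hu⟩

theorem lt_eventually_const {f g : ℕ → ℕ} (hf : Monotone f) (hg : Monotone g)
    (h : (∃ n, ∀ᶠ u in atTop, f u = n) ∨ ∃ n, ∀ᶠ u in atTop, g u = n) :
    (∀ᶠ u in atTop, f u < g u) ∨ ∀ᶠ u in atTop, ¬ f u < g u := by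
  rcases h with ⟨n, hn⟩ | ⟨n, hn⟩
  · by_cases hex : ∃ u, n < g u
    · obtain ⟨v, hv⟩ := hex
      left
      filter_upwards [hn, eventually_ge_atTop v] with u hu huv
      exact hu ▸ hv.trans_le (hg huv)
    · push Not at hex
      exact .inr (hn.mono fun u hu => by simpa [hu] using hex u)
  · by_cases hex : ∃ u, n ≤ f u
    · obtain ⟨v, hv⟩ := hex
      right
      filter_upwards [hn, eventually_ge_atTop v] with u hu huv
      exact not_lt.2 (hu ▸ hv.trans (hf huv))
    · push Not at hex
      exact .inl (hn.mono fun u hu => by simpa [hu] using hex u)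

section Counter

variable {E : ℕ → ℕ → Prop} {l : ℕ → ℕ → ℕ → ℕ}

theorem colourOfImages_eventually_const (hE : Equivalence E) (hmono : ∀ x y, Monotone (l x y))
    (hpos : ∀ x y, E x y → Tendsto (l x y) atTop atTop)
    (hneg : ∀ x y, ¬ E x y → ∃ n, ∀ᶠ u in atTop, l x y u = n) (i a₀ a₁ b : ℕ) :
    ∃ v, ∀ᶠ u in atTop, colourOfImages l u i a₀ a₁ b = v := by
  by_cases h : E a₀ a₁
  · refine ⟨false, ((hpos _ _ h).eventually_gt_atTop i).mono fun u hu => ?_⟩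
    simp only [colourOfImages, Bool.and_eq_false_imp, decide_eq_true_eq]
    omega
  · obtain ⟨n, hn⟩ := hneg _ _ h
    have hb : ¬ E b a₁ ∨ ¬ E b a₀ := by
      by_contra! hcon
      exact h (hE.trans (hE.symm hcon.2) hcon.1)
    obtain ⟨v, hv⟩ := decide_eventually_const_of_eventually
      (lt_eventually_const (hmono b a₁) (hmono b a₀) (hb.imp (hneg _ _) (hneg _ _)))
    refine ⟨decide (n + 2 = i) && v, ?_⟩
    filter_upwards [hn, hv] with u hu hu'
    rw [colourOfImages, hu, hu']

theorem colour_eventually_const (hE : Equivalence E) (hmono : ∀ x y, Monotone (l x y))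
    (hpos : ∀ x y, E x y → Tendsto (l x y) atTop atTop)
    (hneg : ∀ x y, ¬ E x y → ∃ n, ∀ᶠ u in atTop, l x y u = n) (x : ℕ) :
    ∃ v, ∀ᶠ u in atTop, colour l x u = v := by
  obtain ⟨o₀, h₀⟩ := evaln_eventually_const (Denumerable.ofNat Code x.unpair.1)
    (Nat.pair x.unpair.1 0)
  obtain ⟨o₁, h₁⟩ := evaln_eventually_const (Denumerable.ofNat Code x.unpair.1)
    (Nat.pair x.unpair.1 1)
  obtain ⟨o, h⟩ := evaln_eventually_const (Denumerable.ofNat Code x.unpair.1) x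
  have hconst : ∃ v, ∀ᶠ u in atTop, ((o₀.bind fun a₀ => o₁.bind fun a₁ => o.map fun b =>
      colourOfImages l u x.unpair.2 a₀ a₁ b).getD false) = v := by
    rcases o₀ with _ | a₀
    · exact ⟨false, .of_forall fun u => rfl⟩
    rcases o₁ with _ | a₁
    · exact ⟨false, .of_forall fun u => rfl⟩
    rcases o with _ | b
    · exact ⟨false, .of_forall fun u => rfl⟩
    exact colourOfImages_eventually_const hE hmono hpos hneg _ a₀ a₁ b
  obtain ⟨v, hv⟩ := hconst
  refine ⟨bif x.unpair.2 == 1 then true else v, ?_⟩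
  filter_upwards [h₀, h₁, h, hv] with u hu₀ hu₁ hu huv
  rw [colour, hu₀, hu₁, hu, huv]

end Counter

theorem colour_pair_zero (l : ℕ → ℕ → ℕ → ℕ) (e u : ℕ) : colour l (Nat.pair e 0) u = false := by
  simp only [colour, colourOfImages, Nat.unpair_pair]
  rcases Code.evaln u (Denumerable.ofNat Code e) (Nat.pair e 0) <;>
    rcases Code.evaln u (Denumerable.ofNat Code e) (Nat.pair e 1) <;> simp

theorem colour_pair_one (l : ℕ → ℕ → ℕ → ℕ) (e u : ℕ) : colour l (Nat.pair e 1) u = true := by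
  simp [colour]

theorem colour_pair_add_two (l : ℕ → ℕ → ℕ → ℕ) {f : ℕ → ℕ} {c : Code}
    (hc : c.eval = fun n => Part.some (f n)) (n : ℕ) :
    ∀ᶠ u in atTop, colour l (Nat.pair (Encodable.encode c) (n + 2)) u =
      colourOfImages l u (n + 2) (f (Nat.pair (Encodable.encode c) 0))
        (f (Nat.pair (Encodable.encode c) 1)) (f (Nat.pair (Encodable.encode c) (n + 2))) := by
  have hev (m : ℕ) : ∀ᶠ u in atTop, Code.evaln u c m = some (f m) := by
    have : f m ∈ c.eval m := by simp [hc]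
    obtain ⟨k, hk⟩ := Code.evaln_complete.1 this
    exact (eventually_ge_atTop k).mono fun v hv => Code.evaln_mono hv hk
  filter_upwards [hev (Nat.pair (Encodable.encode c) 0), hev (Nat.pair (Encodable.encode c) 1),
    hev (Nat.pair (Encodable.encode c) (n + 2))] with u h₀ h₁ h₂
  simp [colour, h₀, h₁, h₂]

/-- No Π⁰₂ equivalence relation bounds all limit computable equivalence relations. -/
theorem Pi02Rel.exists_limitComputable_not_reducible {E : ℕ → ℕ → Prop} (hE : Pi02Rel E)
    (hEq : Equivalence E) : ∃ F : ℕ → ℕ → Prop,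
      LimitComputableRel F ∧ Equivalence F ∧ ¬ ComputablyReducible F E := by
  obtain ⟨l, hl, hmono, hpos, hneg⟩ := hE.exists_counter
  choose C hC using colour_eventually_const hEq hmono hpos hneg
  have hC' {x : ℕ} {v : Bool} (h : ∀ᶠ u in atTop, colour l x u = v) : C x = v := by
    obtain ⟨u, hu, hu'⟩ := ((hC x).and h).exists
    exact hu.symm.trans hu'
  refine ⟨fun x y => x.unpair.1 = y.unpair.1 ∧ C x = C y,
    ⟨fun x y u => decide (x.unpair.1 = y.unpair.1) && (colour l x u == colour l y u), ?_, ?_⟩,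
    ⟨fun x => ⟨rfl, rfl⟩, fun h => ⟨h.1.symm, h.2.symm⟩,
      fun h h' => ⟨h.1.trans h'.1, h.2.trans h'.2⟩⟩, ?_⟩
  · have hx : Computable fun p : ℕ × ℕ × ℕ => p.1 := Computable.fst
    have hy : Computable fun p : ℕ × ℕ × ℕ => p.2.1 := Computable.fst.comp Computable.snd
    have hu : Computable fun p : ℕ × ℕ × ℕ => p.2.2 := Computable.snd.comp Computable.snd
    exact Primrec.and.to_comp.comp
      (Primrec.eq.decide.to_comp.comp (Computable.fst.comp (Computable.unpair.comp hx))
        (Computable.fst.comp (Computable.unpair.comp hy)))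
      (Primrec.beq.to_comp.comp ((colour_computable hl).comp hx hu)
        ((colour_computable hl).comp hy hu))
  · intro x y
    obtain ⟨s₀, hs₀⟩ := eventually_atTop.1 ((hC x).and (hC y))
    refine ⟨s₀, fun s hs => ?_⟩
    simp [(hs₀ s hs).1, (hs₀ s hs).2]
  · rintro ⟨f, hf, hred⟩
    obtain ⟨c, hc⟩ := Code.exists_code.1 (Partrec.nat_iff.1 hf)
    obtain ⟨e, he⟩ : ∃ e, e = Encodable.encode c := ⟨_, rfl⟩
    have hC₀ : C (Nat.pair e 0) = false := hC' (.of_forall (colour_pair_zero l e))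
    have hC₁ : C (Nat.pair e 1) = true := hC' (.of_forall (colour_pair_one l e))
    have h₀₁ : ¬ E (f (Nat.pair e 0)) (f (Nat.pair e 1)) := by
      simp [← hred, hC₀, hC₁]
    obtain ⟨n, hn⟩ := hneg _ _ h₀₁
    have hCn : ∀ᶠ u in atTop, C (Nat.pair e (n + 2)) =
        decide (l (f (Nat.pair e (n + 2))) (f (Nat.pair e 1)) u <
          l (f (Nat.pair e (n + 2))) (f (Nat.pair e 0)) u) := by
      filter_upwards [hC (Nat.pair e (n + 2)), he ▸ colour_pair_add_two l hc n, hn] with u h₁ h₂ h₃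
      rw [← h₁, h₂, colourOfImages, h₃]
      simp
    cases hv : C (Nat.pair e (n + 2)) with
    | true =>
      have hb₁ : E (f (Nat.pair e (n + 2))) (f (Nat.pair e 1)) :=
        (hred _ _).1 ⟨by simp, hv.trans hC₁.symm⟩
      obtain ⟨m, hm⟩ := hneg (f (Nat.pair e (n + 2))) (f (Nat.pair e 0)) fun hb₀ =>
        h₀₁ (hEq.trans (hEq.symm hb₀) hb₁)
      obtain ⟨u, h₁, h₂, h₃⟩ :=
        (hCn.and (hm.and ((hpos _ _ hb₁).eventually_ge_atTop m))).exists
      rw [hv, eq_comm, decide_eq_true_eq] at h₁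
      omega
    | false =>
      have hb₀ : E (f (Nat.pair e (n + 2))) (f (Nat.pair e 0)) :=
        (hred _ _).1 ⟨by simp, hv.trans hC₀.symm⟩
      obtain ⟨m, hm⟩ := hneg (f (Nat.pair e (n + 2))) (f (Nat.pair e 1)) fun hb₁ =>
        h₀₁ (hEq.trans (hEq.symm hb₀) hb₁)
      obtain ⟨u, h₁, h₂, h₃⟩ :=
        (hCn.and (hm.and ((hpos _ _ hb₀).eventually_gt_atTop m))).exists
      rw [hv, eq_comm, decide_eq_false_iff_not] at h₁
      omega

/-- No Π⁰₂ preorder bounds all limit computable equivalence relations. -/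
theorem Pi02Rel.exists_limitComputable_not_reducible_of_preorder {P : ℕ → ℕ → Prop}
    (hP : Pi02Rel P) (hrefl : ∀ x, P x x) (htrans : ∀ x y z, P x y → P y z → P x z) :
    ∃ F : ℕ → ℕ → Prop,
      LimitComputableRel F ∧ Equivalence F ∧ ¬ ComputablyReducible F P := by
  obtain ⟨F, hF, hFeq, hnot⟩ := hP.symmetric_part.exists_limitComputable_not_reducible
    ⟨fun x => ⟨hrefl x, hrefl x⟩, And.symm,
      fun h h' => ⟨htrans _ _ _ h.1 h'.1, htrans _ _ _ h'.2 h.2⟩⟩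
  refine ⟨F, hF, hFeq, fun ⟨f, hf, hred⟩ => hnot ⟨f, hf, fun x y => ?_⟩⟩
  simp only [← hred]
  exact ⟨fun h => ⟨h, hFeq.symm h⟩, And.left⟩

/-- There is no Π⁰₂-complete preorder, no Δ⁰₂-complete equivalence relation,
and no Δ⁰₂-complete preorder. -/
theorem stmt_8 :
    (¬ ∃ P : ℕ → ℕ → Prop, Pi02Rel P ∧ Reflexive P ∧ Transitive P ∧
        ∀ Q : ℕ → ℕ → Prop, Pi02Rel Q → Reflexive Q → Transitive Q →
          ComputablyReducible Q P) ∧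
    (¬ ∃ E : ℕ → ℕ → Prop, LimitComputableRel E ∧ Equivalence E ∧
        ∀ F : ℕ → ℕ → Prop, LimitComputableRel F → Equivalence F →
          ComputablyReducible F E) ∧
    (¬ ∃ P : ℕ → ℕ → Prop, LimitComputableRel P ∧ Reflexive P ∧ Transitive P ∧
        ∀ Q : ℕ → ℕ → Prop, LimitComputableRel Q → Reflexive Q → Transitive Q →
          ComputablyReducible Q P) := by
  refine ⟨?_, ?_, ?_⟩
  · rintro ⟨P, hP, hrefl, htrans, hcomplete⟩
    obtain ⟨F, hF, hFeq, hnot⟩ :=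
      hP.exists_limitComputable_not_reducible_of_preorder hrefl
        (fun _ _ _ h h' => htrans h h')
    exact hnot (hcomplete F hF.pi02Rel (fun x => hFeq.refl x) fun _ _ _ h h' => hFeq.trans h h')
  · rintro ⟨E, hE, hEq, hcomplete⟩
    obtain ⟨F, hF, hFeq, hnot⟩ := hE.pi02Rel.exists_limitComputable_not_reducible hEq
    exact hnot (hcomplete F hF hFeq)
  · rintro ⟨P, hP, hrefl, htrans, hcomplete⟩
    obtain ⟨F, hF, hFeq, hnot⟩ :=
      hP.pi02Rel.exists_limitComputable_not_reducible_of_preorder hrefl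
        (fun _ _ _ h h' => htrans h h')
    exact hnot (hcomplete F hF (fun x => hFeq.refl x) fun _ _ _ h h' => hFeq.trans h h')
end

section
/- The relation of almost inclusion on recursively enumerable sets, P e i ↔ W_e ⊆* W_i, is a Σ⁰₃-complete preorder: (a) P is a preorder on ℕ and is Σ⁰₃, i.e. there is a computable M : ℕ → ℕ → ℕ → ℕ → ℕ → Bool with W_e ⊆* W_i ↔ ∃ a, ∀ b, ∃ c, M e i a b c = true for all e, i; and (b) for every Σ⁰₃ preorder R on ℕ there is a total computable f : ℕ → ℕ such that for all i, j: R i j ↔ W_{f i} ⊆* W_{f j}. -/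
/-- The `e`-th computably enumerable set: the domain of the `e`-th partial
computable function under the standard numbering. -/
def W (e : ℕ) : Set ℕ :=
  {n | ((Denumerable.ofNat Nat.Partrec.Code e).eval n).Dom}

/-- A binary relation on ℕ is Σ⁰₃. -/
def Sigma03Rel (P : ℕ → ℕ → Prop) : Prop :=
  ∃ M : ℕ → ℕ → ℕ → ℕ → ℕ → Bool,
    Computable (fun p : ℕ × ℕ × ℕ × ℕ × ℕ => M p.1 p.2.1 p.2.2.1 p.2.2.2.1 p.2.2.2.2) ∧
    ∀ x y, P x y ↔ ∃ a, ∀ b, ∃ c, M x y a b c = true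

/-- `A` is almost contained in `B`: `A \ B` is finite. -/
def AlmostSubset (A B : Set ℕ) : Prop := (A \ B).Finite

/-- A predicate is Σ⁰₁ if it is the projection of a computable relation. -/
def IsSigma1 {α : Type*} [Primcodable α] (p : α → Prop) : Prop :=
  ∃ f : α → ℕ → Bool, Computable₂ f ∧ ∀ x, p x ↔ ∃ t, f x t = true

namespace IsSigma1

variable {α β : Type*} [Primcodable α] [Primcodable β]

theorem of_computable {f : α → Bool} (hf : Computable f) : IsSigma1 fun x => f x = true :=
  ⟨fun x _ => f x, hf.comp .fst, fun x => by simp⟩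

theorem of_computablePred {p : α → Prop} (hp : ComputablePred p) : IsSigma1 p := by
  obtain ⟨_, hp⟩ := hp
  simpa using of_computable hp

theorem comp {p : β → Prop} (hp : IsSigma1 p) {g : α → β} (hg : Computable g) :
    IsSigma1 fun x => p (g x) := by
  obtain ⟨f, hf, h⟩ := hp
  exact ⟨fun x t => f (g x) t, hf.comp (hg.comp .fst) .snd, fun x => h (g x)⟩

theorem and {p q : α → Prop} (hp : IsSigma1 p) (hq : IsSigma1 q) :
    IsSigma1 fun x => p x ∧ q x := by
  obtain ⟨f, hf, h⟩ := hp
  obtain ⟨g, hg, h'⟩ := hq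
  refine ⟨fun x t => f x t.unpair.1 && g x t.unpair.2,
    Primrec.and.to_comp.comp
      (hf.comp .fst (Computable.fst.comp (Computable.unpair.comp .snd)))
      (hg.comp .fst (Computable.snd.comp (Computable.unpair.comp .snd))), fun x => ?_⟩
  simp only [h, h']
  constructor
  · rintro ⟨⟨s, hs⟩, t, ht⟩
    exact ⟨Nat.pair s t, by simp [hs, ht]⟩
  · rintro ⟨t, ht⟩
    simp only [Bool.and_eq_true] at ht
    exact ⟨⟨_, ht.1⟩, _, ht.2⟩

theorem or {p q : α → Prop} (hp : IsSigma1 p) (hq : IsSigma1 q) :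
    IsSigma1 fun x => p x ∨ q x := by
  obtain ⟨f, hf, h⟩ := hp
  obtain ⟨g, hg, h'⟩ := hq
  refine ⟨fun x t => f x t || g x t, Primrec.or.to_comp.comp hf hg, fun x => ?_⟩
  simp only [h, h', Bool.or_eq_true, exists_or]

theorem exists_nat {p : α → ℕ → Prop} (hp : IsSigma1 fun z : α × ℕ => p z.1 z.2) :
    IsSigma1 fun x => ∃ n, p x n := by
  obtain ⟨f, hf, h⟩ := hp
  refine ⟨fun x t => f (x, t.unpair.1) t.unpair.2,
    hf.comp (Computable.fst.pair (Computable.fst.comp (Computable.unpair.comp .snd)))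
      (Computable.snd.comp (Computable.unpair.comp .snd)), fun x => ?_⟩
  constructor
  · rintro ⟨n, hn⟩
    obtain ⟨t, ht⟩ := (h (x, n)).1 hn
    exact ⟨Nat.pair n t, by simpa using ht⟩
  · rintro ⟨t, ht⟩
    exact ⟨_, (h (x, _)).2 ⟨_, ht⟩⟩

theorem exists_denumerable {γ : Type*} [Denumerable γ] {p : α → γ → Prop}
    (hp : IsSigma1 fun z : α × γ => p z.1 z.2) : IsSigma1 fun x => ∃ c, p x c := by
  have := (IsSigma1.exists_nat (p := fun x n => p x (Denumerable.ofNat γ n)) <|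
    hp.comp (g := fun z : α × ℕ => (z.1, Denumerable.ofNat γ z.2))
    (Computable.fst.pair ((Computable.ofNat γ).comp .snd)))
  convert this using 3 with x
  constructor
  · rintro ⟨c, hc⟩
    exact ⟨Encodable.encode c, by simpa using hc⟩
  · rintro ⟨n, hn⟩
    exact ⟨_, hn⟩

theorem forall_lt {p : α → ℕ → Prop} (hp : IsSigma1 fun z : α × ℕ => p z.1 z.2)
    {g : α → ℕ} (hg : Computable g) : IsSigma1 fun x => ∀ b < g x, p x b := by
  obtain ⟨f, hf, h⟩ := hp
  let F : α × List ℕ → Bool := fun z =>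
    Nat.rec true (fun b r => r && f (z.1, b) (z.2.getD b 0)) (g z.1)
  have hF : Computable F := by
    have hstep : Computable₂ fun (z : α × List ℕ) (w : ℕ × Bool) =>
        w.2 && f (z.1, w.1) (z.2.getD w.1 0) := by
      refine Primrec.and.to_comp.comp (Computable.snd.comp .snd) (hf.comp ?_ ?_)
      · exact (Computable.fst.comp .fst).pair (Computable.fst.comp .snd)
      · exact (Primrec.list_getD 0).to_comp.comp (Computable.snd.comp .fst)
          (Computable.fst.comp .snd)
    exact Computable.nat_rec (hg.comp .fst) (.const true) hstep
  have hF_iff (x : α) (l : List ℕ) :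
      F (x, l) = true ↔ ∀ b < g x, f (x, b) (l.getD b 0) = true := by
    have (k : ℕ) : (Nat.rec true (fun b r => r && f (x, b) (l.getD b 0)) k : Bool) = true ↔
        ∀ b < k, f (x, b) (l.getD b 0) = true := by
      induction k with
      | zero => simp
      | succ k ih => rw [Nat.forall_lt_succ_right, ← ih, Bool.and_eq_true]
    exact this (g x)
  have hE : IsSigma1 fun x => ∃ l, F (x, l) = true :=
    exists_denumerable (p := fun x l => F (x, l) = true) (of_computable hF)
  convert hE using 2 with x
  simp only [hF_iff]
  constructor
  · intro hx
    choose! t ht using fun b hb => (h (x, b)).1 (hx b hb)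
    refine ⟨(List.range (g x)).map t, fun b hb => ?_⟩
    simpa [List.getD, hb] using ht b hb
  · rintro ⟨l, hl⟩ b hb
    exact (h (x, b)).2 ⟨_, hl b hb⟩

end IsSigma1

theorem reflTransGen_iff_exists_list {r : ℕ → ℕ → Prop} {a b : ℕ} :
    Relation.ReflTransGen r a b ↔ ∃ (l : List ℕ) (k : ℕ), l.getD 0 0 = a ∧ l.getD k 0 = b ∧
      ∀ m < k, r (l.getD m 0) (l.getD (m + 1) 0) := by
  constructor
  · intro h
    suffices ∃ (g : ℕ → ℕ) (k : ℕ), g 0 = a ∧ g k = b ∧ ∀ m < k, r (g m) (g (m + 1)) by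
      obtain ⟨g, k, h0, hk, hg⟩ := this
      have hl (m : ℕ) (hm : m ≤ k) : ((List.range (k + 1)).map g).getD m 0 = g m := by
        simp [List.getD, Nat.lt_succ_of_le hm]
      refine ⟨(List.range (k + 1)).map g, k, ?_, ?_, fun m hm => ?_⟩
      · rw [hl 0 (Nat.zero_le k), h0]
      · rw [hl k le_rfl, hk]
      · rw [hl m hm.le, hl (m + 1) hm]
        exact hg m hm
    induction h with
    | refl => exact ⟨fun _ => a, 0, rfl, rfl, by simp⟩
    | @tail b c _ hbc ih =>
      obtain ⟨g, k, h0, hk, hg⟩ := ih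
      refine ⟨fun m => if m ≤ k then g m else c, k + 1, by simpa using h0, by simp, ?_⟩
      intro m hm
      rcases Nat.lt_succ_iff_lt_or_eq.1 hm with hm' | rfl
      · simpa [hm'.le, Nat.succ_le_of_lt hm'] using hg m hm'
      · simpa [hk] using hbc
  · rintro ⟨l, k, rfl, rfl, h⟩
    induction k with
    | zero => exact .refl
    | succ k ih => exact (ih fun m hm => h m (hm.trans k.lt_succ_self)).tail (h k k.lt_succ_self)

theorem IsSigma1.reflTransGen {α : Type*} [Primcodable α] {r : α → ℕ → ℕ → Prop}
    (hr : IsSigma1 fun z : α × ℕ × ℕ => r z.1 z.2.1 z.2.2) :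
    IsSigma1 fun z : α × ℕ × ℕ => Relation.ReflTransGen (r z.1) z.2.1 z.2.2 := by
  simp only [reflTransGen_iff_exists_list]
  have hget : Computable₂ fun (l : List ℕ) (m : ℕ) => l.getD m 0 := (Primrec.list_getD 0).to_comp
  have hl : Computable fun y : ((α × ℕ × ℕ) × List ℕ) × ℕ => y.1.2 := Computable.snd.comp .fst
  have heq : ComputablePred fun z : ℕ × ℕ => z.1 = z.2 :=
    ⟨inferInstance, (Primrec.eq (α := ℕ)).decide.to_comp⟩
  refine IsSigma1.exists_denumerable (IsSigma1.exists_nat (.and ?_ (.and ?_ ?_)))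
  · exact (of_computablePred heq).comp ((hget.comp hl (.const 0)).pair
      (Computable.fst.comp (Computable.snd.comp (Computable.fst.comp .fst))))
  · exact (of_computablePred heq).comp ((hget.comp hl .snd).pair
      (Computable.snd.comp (Computable.snd.comp (Computable.fst.comp .fst))))
  · refine IsSigma1.forall_lt ?_ Computable.snd
    exact hr.comp ((Computable.fst.comp (Computable.fst.comp (Computable.fst.comp .fst))).pair
      ((hget.comp (hl.comp .fst) .snd).pair
        (hget.comp (hl.comp .fst) (Computable.succ.comp .snd))))

theorem IsSigma1.partrec_dom {α : Type*} [Primcodable α] {p : α → Prop} (hp : IsSigma1 p) :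
    ∃ f : α →. ℕ, Partrec f ∧ ∀ x, (f x).Dom ↔ p x := by
  obtain ⟨f, hf, h⟩ := hp
  refine ⟨fun x => Nat.rfind fun t => Part.some (f x t), Partrec.rfind hf.partrec₂, fun x => ?_⟩
  rw [h]
  refine Nat.rfind_dom.trans ?_
  simp only [Part.mem_some_iff, Part.some_dom, implies_true, and_true, eq_comm]

/-- The parameter theorem for uniformly c.e. families of sets. -/
theorem IsSigma1.exists_computable_index {p : ℕ → ℕ → Prop}
    (hp : IsSigma1 fun z : ℕ × ℕ => p z.1 z.2) :
    ∃ f : ℕ → ℕ, Computable f ∧ ∀ j x, x ∈ W (f j) ↔ p j x := by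
  obtain ⟨g, hg, h⟩ := (hp.comp Computable.unpair).partrec_dom
  obtain ⟨c, rfl⟩ := Nat.Partrec.Code.exists_code.1 (Partrec.nat_iff.1 hg)
  refine ⟨fun j => Encodable.encode (c.curry j), Computable.encode.comp
    (Nat.Partrec.Code.primrec₂_curry.to_comp.comp (.const c) .id), fun j x => ?_⟩
  simp [W, Nat.Partrec.Code.eval_curry, h]

theorem almostSubset_refl (A : Set ℕ) : AlmostSubset A A := by simp [AlmostSubset]

theorem AlmostSubset.trans {A B C : Set ℕ} (h₁ : AlmostSubset A B) (h₂ : AlmostSubset B C) :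
    AlmostSubset A C :=
  (Set.Finite.union h₁ h₂).subset fun x hx => by
    by_cases hB : x ∈ B
    · exact .inr ⟨hB, hx.2⟩
    · exact .inl ⟨hx.1, hB⟩

theorem mem_W_iff {e x : ℕ} :
    x ∈ W e ↔ ∃ t, (Nat.Partrec.Code.evaln t (Denumerable.ofNat _ e) x).isSome = true := by
  simp only [W, Set.mem_ofPred_eq, Part.dom_iff_mem, Nat.Partrec.Code.evaln_complete,
    Option.isSome_iff_exists, Option.mem_def]
  exact exists_comm

theorem sigma03Rel_almostSubset : Sigma03Rel fun e i => AlmostSubset (W e) (W i) := by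
  let ev (t e x : ℕ) : Bool :=
    (Nat.Partrec.Code.evaln t (Denumerable.ofNat Nat.Partrec.Code e) x).isSome
  have hev : Computable fun p : ℕ × ℕ × ℕ => ev p.1 p.2.1 p.2.2 :=
    (Primrec.option_isSome.comp (Nat.Partrec.Code.primrec_evaln.comp
      ((Primrec.fst.pair ((Primrec.ofNat _).comp (Primrec.fst.comp .snd))).pair
        (Primrec.snd.comp .snd)))).to_comp
  refine ⟨fun e i a b c =>
    decide (b.unpair.1 < a) || (!ev b.unpair.2 e b.unpair.1 || ev c i b.unpair.1), ?_, ?_⟩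
  · have he : Computable fun p : ℕ × ℕ × ℕ × ℕ × ℕ => p.1 := .fst
    have hi : Computable fun p : ℕ × ℕ × ℕ × ℕ × ℕ => p.2.1 := Computable.fst.comp .snd
    have ha : Computable fun p : ℕ × ℕ × ℕ × ℕ × ℕ => p.2.2.1 :=
      Computable.fst.comp (Computable.snd.comp .snd)
    have hb : Computable fun p : ℕ × ℕ × ℕ × ℕ × ℕ => p.2.2.2.1.unpair :=
      Computable.unpair.comp (Computable.fst.comp (Computable.snd.comp (Computable.snd.comp .snd)))
    have hc : Computable fun p : ℕ × ℕ × ℕ × ℕ × ℕ => p.2.2.2.2 :=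
      Computable.snd.comp (Computable.snd.comp (Computable.snd.comp .snd))
    have hb₁ := Computable.fst.comp hb
    have hb₂ := Computable.snd.comp hb
    have hor : Computable₂ or := Primrec.or.to_comp
    have hlt : Computable₂ fun m n : ℕ => decide (m < n) := Primrec.nat_lt.decide.to_comp
    have hlt' := hlt.comp hb₁ ha
    have hev₁ := Primrec.not.to_comp.comp (hev.comp (hb₂.pair (he.pair hb₁)))
    have hev₂ := hev.comp (hc.pair (hi.pair hb₁))
    exact hor.comp hlt' (hor.comp hev₁ hev₂)
  · intro e i
    have hfin : AlmostSubset (W e) (W i) ↔ ∃ a, ∀ x, x ∈ W e \ W i → x < a := by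
      rw [AlmostSubset, Set.finite_iff_bddAbove]
      constructor
      · rintro ⟨a, ha⟩
        exact ⟨a + 1, fun x hx => Nat.lt_succ_of_le (ha hx)⟩
      · rintro ⟨a, ha⟩
        exact ⟨a, fun x hx => (ha x hx).le⟩
    refine hfin.trans ?_
    refine exists_congr fun a => ?_
    constructor
    · intro h b
      by_cases hlt : b.unpair.1 < a
      · exact ⟨0, by simp [hlt]⟩
      by_cases hbe : ev b.unpair.2 e b.unpair.1 = true
      · have hxi : b.unpair.1 ∈ W i := by
          by_contra hxi
          exact hlt (h _ ⟨mem_W_iff.2 ⟨_, hbe⟩, hxi⟩)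
        obtain ⟨c, hc⟩ := mem_W_iff.1 hxi
        exact ⟨c, by simp [ev, hc]⟩
      · exact ⟨0, by simp [hbe]⟩
    · rintro h x ⟨hxe, hxi⟩
      obtain ⟨t, ht⟩ := mem_W_iff.1 hxe
      obtain ⟨c, hc⟩ := h (Nat.pair x t)
      by_contra hlt
      have hte : ev t e x = true := ht
      simp only [Nat.unpair_pair, hlt, hte, decide_false, Bool.not_true, Bool.false_or] at hc
      exact hxi (mem_W_iff.2 ⟨c, hc⟩)

section Completeness

variable (M : ℕ → ℕ → ℕ → ℕ → ℕ → Bool)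

/-- Among vertices and outer witnesses at most `n`, the Σ⁰₃ relation given by `M` still looks true
at `(u, v)` after its inner Π⁰₂ condition has been tested below `s`. -/
def ApproxEdge (n s u v : ℕ) : Prop :=
  u ≤ n ∧ v ≤ n ∧ ∃ a, a ≤ n ∧ ∀ b < s, ∃ c, M u v a b c = true

/-- Reachability along the edges of `ApproxEdge`. -/
def ApproxReach (n s : ℕ) : ℕ → ℕ → Prop :=
  Relation.ReflTransGen (ApproxEdge M n s)

/-- Membership of the element coded by `(n, i, k, s)` in the `j`-th set of the reduction. If `s` is
the last stage at which `k` is reachable from `i`, the element separates the `i`-th set from the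
`k`-th one. -/
def ReductionMem (j : ℕ) (x : ℕ × ℕ × ℕ × ℕ) : Prop :=
  (x.2.1 ≤ x.1 ∧ x.2.2.1 ≤ x.1) ∧ ApproxReach M x.1 x.2.2.2 x.2.1 x.2.2.1 ∧
    (ApproxReach M x.1 (x.2.2.2 + 1) x.2.1 j ∨ ApproxReach M x.1 (x.2.2.2 + 1) x.2.1 x.2.2.1)

variable {M}

theorem ApproxReach.anti {n s t u v : ℕ} (hst : s ≤ t) (h : ApproxReach M n t u v) :
    ApproxReach M n s u v :=
  Relation.ReflTransGen.mono (r := ApproxEdge M n t) (fun _ _ ⟨hu, hv, a, ha, hb⟩ =>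
    ⟨hu, hv, a, ha, fun b hbs => hb b (hbs.trans_le hst)⟩) _ _ h

theorem approxReach_zero {n u v : ℕ} (hu : u ≤ n) (hv : v ≤ n) : ApproxReach M n 0 u v :=
  .single ⟨hu, hv, 0, Nat.zero_le n, by simp⟩

theorem isSigma1_reductionMem
    (hM : Computable (fun p : ℕ × ℕ × ℕ × ℕ × ℕ => M p.1 p.2.1 p.2.2.1 p.2.2.2.1 p.2.2.2.2)) :
    IsSigma1 fun z : ℕ × ℕ × ℕ × ℕ × ℕ => ReductionMem M z.1 z.2 := by
  have hle : IsSigma1 fun z : ℕ × ℕ => z.1 ≤ z.2 :=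
    .of_computablePred ⟨inferInstance, Primrec.nat_le.decide.to_comp⟩
  have hedge : IsSigma1 fun z : (ℕ × ℕ) × ℕ × ℕ => ApproxEdge M z.1.1 z.1.2 z.2.1 z.2.2 := by
    have hn : Computable fun z : (ℕ × ℕ) × ℕ × ℕ => z.1.1 := Computable.fst.comp .fst
    have hs : Computable fun z : (ℕ × ℕ) × ℕ × ℕ => z.1.2 := Computable.snd.comp .fst
    have hu : Computable fun z : (ℕ × ℕ) × ℕ × ℕ => z.2.1 := Computable.fst.comp .snd
    have hv : Computable fun z : (ℕ × ℕ) × ℕ × ℕ => z.2.2 := Computable.snd.comp .snd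
    have hx : Computable fun y : ((((ℕ × ℕ) × ℕ × ℕ) × ℕ) × ℕ) × ℕ => y.1.1.1 :=
      Computable.fst.comp (Computable.fst.comp .fst)
    have hu' := hu.comp hx
    have hv' := hv.comp hx
    have ha : Computable fun y : ((((ℕ × ℕ) × ℕ × ℕ) × ℕ) × ℕ) × ℕ => y.1.1.2 :=
      Computable.snd.comp (Computable.fst.comp .fst)
    have hb : Computable fun y : ((((ℕ × ℕ) × ℕ × ℕ) × ℕ) × ℕ) × ℕ => y.1.2 :=
      Computable.snd.comp .fst
    have hM' := hM.comp (hu'.pair (hv'.pair (ha.pair (hb.pair .snd))))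
    have hMx : IsSigma1 fun y : ((((ℕ × ℕ) × ℕ × ℕ) × ℕ) × ℕ) × ℕ =>
        M y.1.1.1.2.1 y.1.1.1.2.2 y.1.1.2 y.1.2 y.2 = true :=
      .of_computable hM'
    have hMb : IsSigma1 fun y : ((ℕ × ℕ) × ℕ × ℕ) × ℕ =>
        ∀ b < y.1.1.2, ∃ c, M y.1.2.1 y.1.2.2 y.2 b c = true :=
      IsSigma1.forall_lt (p := fun (y : ((ℕ × ℕ) × ℕ × ℕ) × ℕ) b =>
          ∃ c, M y.1.2.1 y.1.2.2 y.2 b c = true)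
        (IsSigma1.exists_nat (p := fun (y : (((ℕ × ℕ) × ℕ × ℕ) × ℕ) × ℕ) c =>
          M y.1.1.2.1 y.1.1.2.2 y.1.2 y.2 c = true) hMx) (hs.comp .fst)
    have hMa : IsSigma1 fun y : (ℕ × ℕ) × ℕ × ℕ =>
        ∃ a, a ≤ y.1.1 ∧ ∀ b < y.1.2, ∃ c, M y.2.1 y.2.2 a b c = true :=
      IsSigma1.exists_nat (p := fun (y : (ℕ × ℕ) × ℕ × ℕ) a =>
          a ≤ y.1.1 ∧ ∀ b < y.1.2, ∃ c, M y.2.1 y.2.2 a b c = true)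
        ((hle.comp (Computable.snd.pair (hn.comp .fst))).and hMb)
    exact (hle.comp (hu.pair hn)).and ((hle.comp (hv.pair hn)).and hMa)
  have hreach : IsSigma1 fun z : (ℕ × ℕ) × ℕ × ℕ => ApproxReach M z.1.1 z.1.2 z.2.1 z.2.2 :=
    IsSigma1.reflTransGen (r := fun w : ℕ × ℕ => ApproxEdge M w.1 w.2) hedge
  have hj : Computable fun z : ℕ × ℕ × ℕ × ℕ × ℕ => z.1 := .fst
  have hn : Computable fun z : ℕ × ℕ × ℕ × ℕ × ℕ => z.2.1 := Computable.fst.comp .snd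
  have hi : Computable fun z : ℕ × ℕ × ℕ × ℕ × ℕ => z.2.2.1 :=
    Computable.fst.comp (Computable.snd.comp .snd)
  have hk : Computable fun z : ℕ × ℕ × ℕ × ℕ × ℕ => z.2.2.2.1 :=
    Computable.fst.comp (Computable.snd.comp (Computable.snd.comp .snd))
  have hs : Computable fun z : ℕ × ℕ × ℕ × ℕ × ℕ => z.2.2.2.2 :=
    Computable.snd.comp (Computable.snd.comp (Computable.snd.comp .snd))
  have hs' := Computable.succ.comp hs
  exact ((hle.comp (hi.pair hn)).and (hle.comp (hk.pair hn))).and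
    ((hreach.comp ((hn.pair hs).pair (hi.pair hk))).and
      ((hreach.comp ((hn.pair hs').pair (hi.pair hj))).or
        (hreach.comp ((hn.pair hs').pair (hi.pair hk)))))

variable {R : ℕ → ℕ → Prop}

theorem finite_reductionMem_diff (hR : ∀ x y, R x y ↔ ∃ a, ∀ b, ∃ c, M x y a b c = true)
    {p q : ℕ} (hpq : R p q) :
    {x | ReductionMem M p x ∧ ¬ ReductionMem M q x}.Finite := by
  obtain ⟨a, ha⟩ := (hR p q).1 hpq
  let N := max a (max p q)
  refine Set.Finite.of_finite_image (f := fun x => (x.1, x.2.1, x.2.2.1))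
    (((Set.finite_Iic N).prod ((Set.finite_Iic N).prod (Set.finite_Iic N))).subset ?_) ?_
  · rintro _ ⟨⟨n, i, k, s⟩, ⟨⟨⟨hi, hk⟩, hv, hp⟩, hq⟩, rfl⟩
    simp only [ReductionMem] at hi hk hv hp hq
    have hnk : ¬ ApproxReach M n (s + 1) i k := fun h => hq ⟨⟨hi, hk⟩, hv, .inr h⟩
    have hnN : n < N := by
      by_contra hN
      have hN : a ≤ n ∧ p ≤ n ∧ q ≤ n := by
        simpa only [N, not_lt, max_le_iff] using hN
      refine hq ⟨⟨hi, hk⟩, hv, .inl ?_⟩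
      exact (hp.resolve_right hnk).tail ⟨hN.2.1, hN.2.2, a, hN.1, fun b _ => ha b⟩
    exact ⟨hnN.le, hi.trans hnN.le, hk.trans hnN.le⟩
  · rintro ⟨n, i, k, s⟩ ⟨⟨⟨hi, hk⟩, hv, _⟩, hq⟩ ⟨n', i', k', s'⟩ ⟨⟨_, hv', _⟩, hq'⟩ h
    simp only [Prod.mk.injEq] at h
    obtain ⟨rfl, rfl, rfl⟩ := h
    have hlast {t t' : ℕ} (ht : ApproxReach M n t i k)
        (hn : ¬ ReductionMem M q (n, i, k, t)) (ht' : ApproxReach M n t' i k) : t' ≤ t := by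
      by_contra hlt
      exact hn ⟨⟨hi, hk⟩, ht, .inr (ht'.anti (not_le.1 hlt))⟩
    have := le_antisymm (hlast hv' hq' hv) (hlast hv hq hv')
    simpa using this

theorem exists_approxEdge_imp (hR : ∀ x y, R x y ↔ ∃ a, ∀ b, ∃ c, M x y a b c = true) (n : ℕ) :
    ∃ s, ∀ u v, ApproxEdge M n s u v → R u v := by
  have key (u v a : ℕ) : ∃ s, (∀ b < s, ∃ c, M u v a b c = true) → R u v := by
    by_cases h : ∀ b, ∃ c, M u v a b c = true
    · exact ⟨0, fun _ => (hR u v).2 ⟨a, h⟩⟩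
    · obtain ⟨b, hb⟩ := not_forall.1 h
      exact ⟨b + 1, fun h' => absurd (h' b b.lt_succ_self) hb⟩
  choose g hg using key
  let I := Finset.range (n + 1)
  refine ⟨(I ×ˢ I ×ˢ I).sup fun z => g z.1 z.2.1 z.2.2, ?_⟩
  rintro u v ⟨hu, hv, a, ha, hb⟩
  refine hg u v a fun b hbs => hb b (hbs.trans_le ?_)
  exact Finset.le_sup (f := fun z : ℕ × ℕ × ℕ => g z.1 z.2.1 z.2.2) (b := (u, v, a))
    (by simp [I, hu, hv, ha])

theorem infinite_reductionMem_diff (hR : ∀ x y, R x y ↔ ∃ a, ∀ b, ∃ c, M x y a b c = true)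
    (hrefl : ∀ x, R x x) (htrans : ∀ ⦃x y z⦄, R x y → R y z → R x z) {i k : ℕ} (hik : ¬ R i k) :
    {x | ReductionMem M i x ∧ ¬ ReductionMem M k x}.Infinite := by
  have hlast (n : ℕ) (hi : i ≤ n) (hk : k ≤ n) :
      ∃ s, ApproxReach M n s i k ∧ ¬ ApproxReach M n (s + 1) i k := by
    by_contra! hstep
    have hall (s : ℕ) : ApproxReach M n s i k := by
      induction s with
      | zero => exact approxReach_zero hi hk
      | succ s ih => exact hstep s ih
    obtain ⟨s, hs⟩ := exists_approxEdge_imp hR n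
    have hgen : Relation.ReflTransGen R i k :=
      Relation.ReflTransGen.mono (r := ApproxEdge M n s) hs _ _ (hall s)
    have hpath {u v : ℕ} (h : Relation.ReflTransGen R u v) : R u v := by
      induction h with
      | refl => exact hrefl u
      | tail _ h ih => exact htrans ih h
    exact hik (hpath hgen)
  refine Set.Infinite.of_image Prod.fst ((Set.Ici_infinite (max i k)).mono fun n hn => ?_)
  obtain ⟨hi, hk⟩ := max_le_iff.1 (Set.mem_Ici.1 hn)
  obtain ⟨s, hs, hs'⟩ := hlast n hi hk
  exact ⟨(n, i, k, s), ⟨⟨⟨hi, hk⟩, hs, .inl .refl⟩, fun h => hs' (or_self_iff.1 h.2.2)⟩, rfl⟩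

theorem exists_computable_reduction (hrefl : ∀ x, R x x)
    (htrans : ∀ ⦃x y z⦄, R x y → R y z → R x z) (hR : Sigma03Rel R) :
    ∃ f : ℕ → ℕ, Computable f ∧ ∀ i j, R i j ↔ AlmostSubset (W (f i)) (W (f j)) := by
  obtain ⟨M, hM, hR⟩ := hR
  obtain ⟨f, hf, hW⟩ := IsSigma1.exists_computable_index
    (p := fun j x => ReductionMem M j (Denumerable.ofNat (ℕ × ℕ × ℕ × ℕ) x))
    ((isSigma1_reductionMem hM).comp (Computable.fst.pair ((Computable.ofNat _).comp .snd)))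
  refine ⟨f, hf, fun i j => ?_⟩
  let e := (Denumerable.eqv (ℕ × ℕ × ℕ × ℕ)).symm
  have hpre : W (f i) \ W (f j) = e ⁻¹' {x | ReductionMem M i x ∧ ¬ ReductionMem M j x} := by
    ext x
    simp only [Set.mem_sdiff, hW]
    rfl
  have hfin : AlmostSubset (W (f i)) (W (f j)) ↔
      {x | ReductionMem M i x ∧ ¬ ReductionMem M j x}.Finite := by
    rw [AlmostSubset, hpre]
    exact ⟨fun h => h.of_preimage e.surjective, fun h => h.preimage e.injective.injOn⟩
  rw [hfin]
  constructor
  · exact finite_reductionMem_diff hR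
  · intro h
    by_contra hij
    exact infinite_reductionMem_diff hR hrefl htrans hij h

end Completeness

/-- Almost inclusion of r.e. sets is a Σ⁰₃-complete preorder. -/
theorem stmt_14 :
    (Reflexive fun e i => AlmostSubset (W e) (W i)) ∧
    (Transitive fun e i => AlmostSubset (W e) (W i)) ∧
    Sigma03Rel (fun e i => AlmostSubset (W e) (W i)) ∧
    ∀ R : ℕ → ℕ → Prop, Reflexive R → Transitive R → Sigma03Rel R →
      ∃ f : ℕ → ℕ, Computable f ∧
        ∀ i j, R i j ↔ AlmostSubset (W (f i)) (W (f j)) :=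
  ⟨fun e => almostSubset_refl (W e), fun _ _ _ => AlmostSubset.trans, sigma03Rel_almostSubset,
    fun _ => exists_computable_reduction⟩
end

section
/- The relation E₂^{ce} on ℕ defined by E₂^{ce} i j ↔ the series ∑_{n ∈ W_i Δ W_j} 1/n converges (i.e. the function fun n : ℕ => if n ∈ (W_i \ W_j) ∪ (W_j \ W_i) then (1 : ℝ)/n else 0 is Summable) is a Σ⁰₃-complete equivalence relation: it is an equivalence relation, it is Σ⁰₃, and every Σ⁰₃ equivalence relation F on ℕ admits a total computable f : ℕ → ℕ with F i j ↔ E₂^{ce} (f i) (f j) for all i, j. -/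
open Classical in
/-- The series `∑_{n ∈ W i Δ W j} 1/n` converges. -/
noncomputable def E2ce (i j : ℕ) : Prop :=
  Summable (fun n : ℕ =>
    if n ∈ (W i \ W j) ∪ (W j \ W i) then (1 : ℝ) / n else 0)

/-- Existential (`Σ⁰₁`) predicates: projections of decidable relations. -/
def SigmaOne {α : Type*} [Primcodable α] (P : α → Prop) : Prop :=
  ∃ g : α → ℕ → Bool, Computable₂ g ∧ ∀ a, P a ↔ ∃ s, g a s = true

namespace SigmaOne

variable {α β : Type*} [Primcodable α] [Primcodable β]

theorem of_eq {P Q : α → Prop} (hP : SigmaOne P) (h : ∀ a, P a ↔ Q a) : SigmaOne Q :=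
  (funext fun a => propext (h a) : P = Q) ▸ hP

theorem of_computable {g : α → Bool} (hg : Computable g) : SigmaOne fun a => g a = true :=
  ⟨fun a _ => g a, hg.comp Computable.fst, by simp⟩

theorem of_primrecPred {P : α → Prop} (hP : PrimrecPred P) : SigmaOne P := by
  obtain ⟨_, h⟩ := hP
  exact (of_computable h.to_comp).of_eq (by simp)

theorem comp {P : β → Prop} (hP : SigmaOne P) {f : α → β} (hf : Computable f) :
    SigmaOne fun a => P (f a) := by
  obtain ⟨g, hg, h⟩ := hP
  exact ⟨fun a s => g (f a) s, hg.comp (hf.comp .fst) .snd, fun a => h (f a)⟩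

theorem and {P Q : α → Prop} (hP : SigmaOne P) (hQ : SigmaOne Q) :
    SigmaOne fun a => P a ∧ Q a := by
  obtain ⟨g, hg, hP⟩ := hP
  obtain ⟨g', hg', hQ⟩ := hQ
  refine ⟨fun a s => g a s.unpair.1 && g' a s.unpair.2,
    Primrec.and.to_comp.comp
      (hg.comp .fst ((Computable.fst.comp Computable.unpair).comp .snd))
      (hg'.comp .fst ((Computable.snd.comp Computable.unpair).comp .snd)), fun a => ?_⟩
  simp only [hP, hQ, Bool.and_eq_true]
  constructor
  · rintro ⟨⟨s, hs⟩, t, ht⟩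
    exact ⟨Nat.pair s t, by simpa using ⟨hs, ht⟩⟩
  · rintro ⟨s, h1, h2⟩
    exact ⟨⟨_, h1⟩, _, h2⟩

theorem or {P Q : α → Prop} (hP : SigmaOne P) (hQ : SigmaOne Q) :
    SigmaOne fun a => P a ∨ Q a := by
  obtain ⟨g, hg, hP⟩ := hP
  obtain ⟨g', hg', hQ⟩ := hQ
  refine ⟨fun a s => g a s || g' a s, Primrec.or.to_comp.comp hg hg', fun a => ?_⟩
  simp only [hP, hQ, Bool.or_eq_true, exists_or]

theorem exists_of {P : α × β → Prop} (hP : SigmaOne P) : SigmaOne fun a => ∃ b, P (a, b) := by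
  obtain ⟨g, hg, h⟩ := hP
  refine ⟨fun a s => Option.casesOn (motive := fun _ => Bool) (Encodable.decode (α := β) s.unpair.1)
      false fun b => g (a, b) s.unpair.2,
    Computable.option_casesOn
      (Computable.decode.comp ((Computable.fst.comp Computable.unpair).comp .snd))
      (.const _)
      (hg.comp ((Computable.fst.comp Computable.fst).pair Computable.snd)
        ((Computable.snd.comp Computable.unpair).comp (Computable.snd.comp .fst))), fun a => ?_⟩
  simp only [h]
  constructor
  · rintro ⟨b, s, hs⟩
    exact ⟨Nat.pair (Encodable.encode b) s, by simpa using hs⟩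
  · rintro ⟨s, hs⟩
    cases hb : Encodable.decode (α := β) s.unpair.1 with
    | none => simp [hb] at hs
    | some b => exact ⟨b, s.unpair.2, by simpa [hb] using hs⟩

end SigmaOne

theorem exists_computable_ballLT {α : Type*} [Primcodable α] {g : α → ℕ → Bool}
    (hg : Computable₂ g) {k : α → ℕ} (hk : Computable k) :
    ∃ F : α → Bool, Computable F ∧ ∀ a, F a = true ↔ ∀ b < k a, g a b = true := by
  refine ⟨_, Computable.nat_rec hk (.const true) (h := fun a p => p.2 && g a p.1)
    (Primrec.and.to_comp.comp (Computable.snd.comp .snd)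
      (hg.comp .fst (Computable.fst.comp .snd))), fun a => ?_⟩
  generalize k a = n
  induction n with
  | zero => simp
  | succ n ih =>
    simp only [Bool.and_eq_true] at ih ⊢
    rw [ih]
    exact Nat.forall_lt_succ_right.symm

theorem exists_computable_bexLT {α : Type*} [Primcodable α] {g : α → ℕ → Bool}
    (hg : Computable₂ g) {k : α → ℕ} (hk : Computable k) :
    ∃ F : α → Bool, Computable F ∧ ∀ a, F a = true ↔ ∃ b < k a, g a b = true := by
  obtain ⟨F, hF, h⟩ := exists_computable_ballLT (g := fun a b => !g a b)
    (Primrec.not.to_comp.comp hg) hk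
  refine ⟨fun a => !F a, Primrec.not.to_comp.comp hF, fun a => ?_⟩
  rw [Bool.not_eq_true', ← Bool.not_eq_true, h]
  simp

theorem SigmaOne.ballLT {α : Type*} [Primcodable α] {P : α × ℕ → Prop} (hP : SigmaOne P)
    {k : α → ℕ} (hk : Computable k) : SigmaOne fun a => ∀ b < k a, P (a, b) := by
  obtain ⟨g, hg, h⟩ := hP
  have h1 : Computable fun r : ((α × ℕ) × ℕ) × ℕ => r.1.1.1 :=
    Computable.fst.comp (Computable.fst.comp .fst)
  have h2 : Computable fun r : ((α × ℕ) × ℕ) × ℕ => r.1.2 := Computable.snd.comp .fst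
  have h3 : Computable₂ fun (q : (α × ℕ) × ℕ) t => g (q.1.1, q.2) t :=
    Computable₂.comp hg (h1.pair h2) .snd
  have h4 : Computable fun q : (α × ℕ) × ℕ => q.1.2 := Computable.snd.comp .fst
  obtain ⟨E, hE, hE'⟩ := exists_computable_bexLT h3 h4
  have h5 : Computable₂ fun (p : α × ℕ) b => E (p, b) := hE
  have h6 : Computable fun p : α × ℕ => k p.1 := hk.comp .fst
  obtain ⟨F, hF, hF'⟩ := exists_computable_ballLT h5 h6
  refine ⟨fun a s => F (a, s), hF, fun a => ?_⟩
  simp only [h, hF', hE']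
  constructor
  · intro H
    choose! t ht using H
    refine ⟨(Finset.range (k a)).sup t + 1, fun b hb => ⟨t b, ?_, ht b hb⟩⟩
    exact Nat.lt_succ_of_le (Finset.le_sup (f := t) (Finset.mem_range.2 hb))
  · rintro ⟨s, hs⟩ b hb
    obtain ⟨t, -, ht⟩ := hs b hb
    exact ⟨t, ht⟩

/-- Parametrization: a `Σ⁰₁` relation is enumerated uniformly in its first argument. -/
theorem SigmaOne.exists_index {Q : ℕ × ℕ → Prop} (hQ : SigmaOne Q) :
    ∃ f : ℕ → ℕ, Computable f ∧ ∀ z m, m ∈ W (f z) ↔ Q (z, m) := by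
  obtain ⟨g, hg, h⟩ := hQ
  have hp : Partrec fun n : ℕ => Nat.rfind fun s => Part.some (g n.unpair s) :=
    Partrec.rfind (p := fun (n : ℕ) s => Part.some (g n.unpair s))
      (hg.comp (Computable.unpair.comp .fst) .snd)
  obtain ⟨c, hc⟩ := Nat.Partrec.Code.exists_code.1 (Partrec.nat_iff.1 hp)
  refine ⟨fun z => Encodable.encode (Nat.Partrec.Code.curry c z),
    (Primrec.encode.comp (Nat.Partrec.Code.primrec₂_curry.comp (.const c) .id)).to_comp,
    fun z m => ?_⟩
  rw [h]
  change ((Denumerable.ofNat Nat.Partrec.Code (Encodable.encode (c.curry z))).eval m).Dom ↔ _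
  rw [Denumerable.ofNat_encode, Nat.Partrec.Code.eval_curry, hc]
  refine Nat.rfind_dom.trans (exists_congr fun s => ?_)
  change (true ∈ Part.some (g (Nat.pair z m).unpair s) ∧ ∀ {t : ℕ}, t < s → True) ↔ _
  rw [Nat.unpair_pair, Part.mem_some_iff]
  exact ⟨fun h => h.1.symm, fun h => ⟨h.symm, fun _ => trivial⟩⟩

theorem sigmaOne_reflTransGen {α : Type*} [Primcodable α] {G : α → ℕ → ℕ → Prop}
    (hG : SigmaOne fun p : α × ℕ × ℕ => G p.1 p.2.1 p.2.2) :
    SigmaOne fun p : α × ℕ × ℕ => Relation.ReflTransGen (G p.1) p.2.1 p.2.2 := by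
  have hgetD : Computable₂ fun (l : List ℕ) (i : ℕ) => l.getD i 0 :=
    (Primrec.list_getD 0).to_comp
  have hpath : SigmaOne fun q : (α × ℕ × ℕ) × List ℕ × ℕ =>
      (q.2.1.getD 0 0 = q.1.2.1 ∧ q.2.1.getD q.2.2 0 = q.1.2.2) ∧
        ∀ i < q.2.2, G q.1.1 (q.2.1.getD i 0) (q.2.1.getD (i + 1) 0) := by
    refine .and (.and (.of_primrecPred ?_) (.of_primrecPred ?_)) ?_
    · exact Primrec.eq.comp ((Primrec.list_getD 0).comp (Primrec.fst.comp .snd) (.const 0))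
        (Primrec.fst.comp (Primrec.snd.comp .fst))
    · exact Primrec.eq.comp
        ((Primrec.list_getD 0).comp (Primrec.fst.comp .snd) (Primrec.snd.comp .snd))
        (Primrec.snd.comp (Primrec.snd.comp .fst))
    · refine SigmaOne.ballLT (P := fun r : ((α × ℕ × ℕ) × List ℕ × ℕ) × ℕ =>
        G r.1.1.1 (r.1.2.1.getD r.2 0) (r.1.2.1.getD (r.2 + 1) 0))
        (hG.comp (f := fun r : ((α × ℕ × ℕ) × List ℕ × ℕ) × ℕ =>
          (r.1.1.1, r.1.2.1.getD r.2 0, r.1.2.1.getD (r.2 + 1) 0)) ?_)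
        (Computable.snd.comp .snd)
      have hl : Computable fun r : ((α × ℕ × ℕ) × List ℕ × ℕ) × ℕ => r.1.2.1 :=
        Computable.fst.comp (Computable.snd.comp .fst)
      exact (Computable.fst.comp (Computable.fst.comp .fst)).pair
        ((hgetD.comp hl .snd).pair (hgetD.comp hl (Computable.succ.comp .snd)))
  refine hpath.exists_of.of_eq fun ⟨a, x, y⟩ => ?_
  constructor
  · rintro ⟨⟨l, n⟩, ⟨h0, hn⟩, hl⟩
    dsimp only at h0 hn hl ⊢
    have key : ∀ i ≤ n, Relation.ReflTransGen (G a) x (l.getD i 0) := by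
      intro i
      induction i with
      | zero => intro _; rw [h0]
      | succ i ih => exact fun hi => (ih (by omega)).tail (hl i (by omega))
    exact hn ▸ key n le_rfl
  · intro h
    dsimp only at h
    induction h using Relation.ReflTransGen.head_induction_on with
    | refl => exact ⟨([y], 0), by simp⟩
    | @head x z hxz _ ih =>
      obtain ⟨⟨l, n⟩, ⟨h0, hn⟩, hl⟩ := ih
      dsimp only at h0 hn hl
      refine ⟨(x :: l, n + 1), ⟨by simp, by simpa using hn⟩, fun i hi => ?_⟩
      dsimp only at hi ⊢
      cases i with
      | zero => change G a x (l.getD 0 0); rwa [h0]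
      | succ i => simpa using hl i (by omega)

/-- Every `Σ⁰₃` equivalence relation is the limit over `n` of equivalence relations, each of which
is the intersection over `k` of a decreasing sequence of uniformly `Σ⁰₁` equivalence relations. -/
theorem exists_sigmaOne_approximation {F : ℕ → ℕ → Prop} (hF : Equivalence F)
    (hF3 : Sigma03Rel F) :
    ∃ R : ℕ → ℕ → ℕ → ℕ → Prop,
      SigmaOne (fun p : (ℕ × ℕ) × ℕ × ℕ => R p.1.1 p.1.2 p.2.1 p.2.2) ∧
      (∀ n k, Equivalence (R n k)) ∧
      (∀ n x y, Antitone fun k => R n k x y) ∧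
      (∀ n x y, x ≤ n → y ≤ n → R n 0 x y) ∧
      (∀ x y, F x y → ∃ N, ∀ n ≥ N, ∀ k, R n k x y) ∧
      ∀ n, ∃ k, ∀ x y, R n k x y → F x y := by
  obtain ⟨M, hM, h⟩ := hF3
  let E : ℕ → ℕ → ℕ → ℕ → Prop := fun n k u v => ∃ a, a ≤ n ∧ ∀ b < k, ∃ c, M u v a b c = true
  let G : ℕ × ℕ → ℕ → ℕ → Prop := fun p u v =>
    (u ≤ p.1 ∧ v ≤ p.1) ∧ (E p.1 p.2 u v ∨ E p.1 p.2 v u)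
  have hE : SigmaOne fun p : (ℕ × ℕ) × ℕ × ℕ => E p.1.1 p.1.2 p.2.1 p.2.2 := by
    refine SigmaOne.exists_of (P := fun q : ((ℕ × ℕ) × ℕ × ℕ) × ℕ =>
      q.2 ≤ q.1.1.1 ∧ ∀ b < q.1.1.2, ∃ c, M q.1.2.1 q.1.2.2 q.2 b c = true) (.and ?_ ?_)
    · exact .of_primrecPred (Primrec.nat_le.comp .snd (Primrec.fst.comp (Primrec.fst.comp .fst)))
    · have h1 : Computable fun s : ((((ℕ × ℕ) × ℕ × ℕ) × ℕ) × ℕ) × ℕ => s.1.1 :=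
        Computable.fst.comp .fst
      have h2 : Computable fun s : ((((ℕ × ℕ) × ℕ × ℕ) × ℕ) × ℕ) × ℕ => s.1.1.1.2 :=
        Computable.snd.comp (Computable.fst.comp h1)
      have hmap : Computable fun s : ((((ℕ × ℕ) × ℕ × ℕ) × ℕ) × ℕ) × ℕ =>
          (s.1.1.1.2.1, s.1.1.1.2.2, s.1.1.2, s.1.2, s.2) :=
        (Computable.fst.comp h2).pair ((Computable.snd.comp h2).pair
          ((Computable.snd.comp h1).pair ((Computable.snd.comp .fst).pair .snd)))
      have hMs := Computable.comp hM hmap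
      have hex : SigmaOne fun r : (((ℕ × ℕ) × ℕ × ℕ) × ℕ) × ℕ =>
          ∃ c, M r.1.1.2.1 r.1.1.2.2 r.1.2 r.2 c = true :=
        (SigmaOne.of_computable hMs).exists_of
      have hk : Computable fun q : ((ℕ × ℕ) × ℕ × ℕ) × ℕ => q.1.1.2 :=
        Computable.snd.comp (Computable.fst.comp .fst)
      exact hex.ballLT hk
  have hG : SigmaOne fun p : (ℕ × ℕ) × ℕ × ℕ => G p.1 p.2.1 p.2.2 := by
    refine .and (.and (.of_primrecPred ?_) (.of_primrecPred ?_)) (.or hE ?_)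
    · exact Primrec.nat_le.comp (Primrec.fst.comp .snd) (Primrec.fst.comp .fst)
    · exact Primrec.nat_le.comp (Primrec.snd.comp .snd) (Primrec.fst.comp .fst)
    · exact hE.comp (f := fun p : (ℕ × ℕ) × ℕ × ℕ => (p.1, p.2.2, p.2.1))
        (Computable.fst.pair ((Computable.snd.comp .snd).pair (Computable.fst.comp .snd)))
  have hsymm : ∀ p, Std.Symm (G p) := fun p => ⟨fun u v h => ⟨⟨h.1.2, h.1.1⟩, h.2.symm⟩⟩
  refine ⟨fun n k => Relation.ReflTransGen (G (n, k)), sigmaOne_reflTransGen hG,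
    fun n k => ⟨fun _ => .refl, fun h => ?_, fun h h' => h.trans h'⟩, ?_, ?_, ?_, ?_⟩
  · have := hsymm (n, k)
    exact symm h
  · intro n x y k l hkl
    have hmono : ∀ u v, E n l u v → E n k u v := fun u v ⟨a, ha, hb⟩ =>
      ⟨a, ha, fun b hbk => hb b (hbk.trans_le hkl)⟩
    have hle : G (n, l) ≤ G (n, k) := fun u v h => ⟨h.1, h.2.imp (hmono u v) (hmono v u)⟩
    exact Relation.ReflTransGen.mono hle x y
  · exact fun n x y hx hy => .single ⟨⟨hx, hy⟩, .inl ⟨0, n.zero_le, by simp⟩⟩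
  · intro x y hxy
    obtain ⟨a, ha⟩ := (h x y).1 hxy
    refine ⟨max a (max x y), fun n hn k => .single ⟨⟨?_, ?_⟩, .inl ⟨a, ?_, fun b _ => ha b⟩⟩⟩ <;>
      dsimp only <;> omega
  · intro n
    have hb : ∀ u v, ¬ F u v → ∀ a, ∃ b, ∀ c, M u v a b c = false := by
      intro u v huv a
      by_contra! H
      exact huv ((h u v).2 ⟨a, by simpa using H⟩)
    choose! B hB using hb
    let s := Finset.range (n + 1)
    let k := (s ×ˢ s ×ˢ s).sup (fun p => B p.1 p.2.1 p.2.2) + 1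
    have hEF : ∀ u v, u ≤ n → v ≤ n → E n k u v → F u v := by
      rintro u v hu hv ⟨a, ha, hab⟩
      by_contra huv
      have hmem : (u, v, a) ∈ s ×ˢ s ×ˢ s := by simp [s]; omega
      obtain ⟨c, hc⟩ := hab (B u v a) (Nat.lt_succ_of_le
        (Finset.le_sup (f := fun p : ℕ × ℕ × ℕ => B p.1 p.2.1 p.2.2) hmem))
      simp [hB u v huv a c] at hc
    refine ⟨k, fun x y hxy => ?_⟩
    induction hxy with
    | refl => exact hF.refl x
    | tail _ hyz ih =>
      exact hF.trans ih (hyz.2.elim (hEF _ _ hyz.1.1 hyz.1.2)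
        fun h => hF.symm (hEF _ _ hyz.1.2 hyz.1.1 h))

/-- Every `Σ⁰₃` equivalence relation reduces to equality modulo finite sets of uniformly `Σ⁰₁`
sets. -/
theorem exists_sigmaOne_finite_iff {F : ℕ → ℕ → Prop} (hF : Equivalence F)
    (hF3 : Sigma03Rel F) :
    ∃ Q : ℕ × ℕ × ℕ × ℕ × ℕ → Prop, SigmaOne Q ∧
      ∀ i j, F i j ↔ {m | ¬ (Q (i, m) ↔ Q (j, m))}.Finite := by
  obtain ⟨R, hR, hequiv, hanti, hzero, hlim, hsub⟩ := exists_sigmaOne_approximation hF hF3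
  refine ⟨fun ⟨z, n, k, x, y⟩ => (x ≤ n ∧ y ≤ n) ∧
    (R n (k + 1) x y ∨ (R n k x y ∧ R n (k + 1) x z)), ?_,
    fun i j => ⟨fun hij => ?_, fun hfin => ?_⟩⟩
  · have hn : Primrec fun p : ℕ × ℕ × ℕ × ℕ × ℕ => p.2.1 := Primrec.fst.comp .snd
    have hk : Primrec fun p : ℕ × ℕ × ℕ × ℕ × ℕ => p.2.2.1 :=
      Primrec.fst.comp (Primrec.snd.comp .snd)
    have hxy : Primrec fun p : ℕ × ℕ × ℕ × ℕ × ℕ => p.2.2.2 :=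
      Primrec.snd.comp (Primrec.snd.comp .snd)
    have hx := Primrec.fst.comp hxy
    have hy := Primrec.snd.comp hxy
    have hk' := Primrec.succ.comp hk
    exact .and (.and (.of_primrecPred (Primrec.nat_le.comp hx hn))
        (.of_primrecPred (Primrec.nat_le.comp hy hn)))
      (.or (hR.comp ((hn.pair hk').pair hxy).to_comp)
        (.and (hR.comp ((hn.pair hk).pair hxy).to_comp)
          (hR.comp ((hn.pair hk').pair (hx.pair Primrec.fst)).to_comp)))
  · obtain ⟨N, hN⟩ := hlim i j hij
    let C : ℕ × ℕ × ℕ → Set (ℕ × ℕ × ℕ × ℕ) := fun t =>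
      (fun k => (t.1, k, t.2)) '' {k | R t.1 k t.2.1 t.2.2 ∧ ¬ R t.1 (k + 1) t.2.1 t.2.2}
    have hC : ∀ t, (C t).Finite := fun t => by
      refine Set.Finite.image _ (Set.Subsingleton.finite ?_)
      rintro k ⟨hk, hk'⟩ l ⟨hl, hl'⟩
      by_contra hne
      rcases lt_or_gt_of_ne hne with h | h
      · exact hk' (hanti _ _ _ (Nat.succ_le_of_lt h) hl)
      · exact hl' (hanti _ _ _ (Nat.succ_le_of_lt h) hk)
    refine Set.Finite.subset
      ((((Set.finite_lt_nat N).prod ((Set.finite_lt_nat N).prod (Set.finite_lt_nat N))).biUnion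
        fun t _ => hC t)) ?_
    rintro ⟨n, k, x, y⟩ hm
    simp only [Set.mem_ofPred_eq] at hm
    have hnN : n < N := by
      by_contra hle
      have hij' := hN n (not_lt.1 hle) (k + 1)
      have hiff : R n (k + 1) x i ↔ R n (k + 1) x j :=
        ⟨fun h => (hequiv _ _).trans h hij', fun h => (hequiv _ _).trans h ((hequiv _ _).symm hij')⟩
      exact hm (by rw [hiff])
    have hxy : x ≤ n ∧ y ≤ n := by by_contra hne; exact hm (by simp [hne])
    have h1 : ¬ R n (k + 1) x y := fun h => hm (by simp [h])
    have h0 : R n k x y := by by_contra hne; exact hm (by simp [hne])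
    refine Set.mem_biUnion (x := (n, x, y)) ?_ ⟨k, ⟨h0, h1⟩, rfl⟩
    simp only [Set.mem_prod, Set.mem_ofPred_eq]
    omega
  · by_contra hij
    have hdiff : ∀ n, max i j ≤ n → ∃ k, R n k i j ∧ ¬ R n (k + 1) i j := by
      intro n hn
      by_contra! H
      obtain ⟨K, hK⟩ := hsub n
      have hall : ∀ k, R n k i j := fun k => by
        induction k with
        | zero => exact hzero n i j (by omega) (by omega)
        | succ k ih => exact H k ih
      exact hij (hK i j (hall K))
    choose! k hk using hdiff
    refine Set.infinite_of_injOn_mapsTo (s := Set.Ici (max i j)) (f := fun n => (n, k n, i, j))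
      (fun a _ b _ hab => congrArg Prod.fst hab) ?_ (Set.Ici_infinite _) hfin
    intro n hn
    obtain ⟨h0, h1⟩ := hk n hn
    have hn' : i ≤ n ∧ j ≤ n := by simpa using hn
    simp [h0, h1, hn', (hequiv n (k n + 1)).refl i]

theorem dyadic_index_unique {a b m : ℕ} (ha : 2 ^ a ≤ m ∧ m < 2 ^ (a + 1))
    (hb : 2 ^ b ≤ m ∧ m < 2 ^ (b + 1)) : a = b := by
  have h1 : a < b + 1 := (Nat.pow_lt_pow_iff_right one_lt_two).1 (ha.1.trans_lt hb.2)
  have h2 : b < a + 1 := (Nat.pow_lt_pow_iff_right one_lt_two).1 (hb.1.trans_lt ha.2)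
  omega

/-- A union of dyadic blocks has finite harmonic sum exactly when there are finitely many. -/
theorem summable_dyadic_blocks_iff {D S : Set ℕ} [DecidablePred (· ∈ S)]
    (hS : ∀ m, m ∈ S ↔ ∃ i ∈ D, 2 ^ i ≤ m ∧ m < 2 ^ (i + 1)) :
    Summable (fun n : ℕ => if n ∈ S then (1 : ℝ) / n else 0) ↔ D.Finite := by
  constructor
  · intro hsum
    by_contra hD
    obtain ⟨s, hs⟩ := summable_iff_vanishing_norm.1 hsum (1 / 2) (by norm_num)
    obtain ⟨i, hi, hlt⟩ := (show D.Infinite from hD).exists_gt (s.sup id)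
    have hdisj : Disjoint (Finset.Ico (2 ^ i) (2 ^ (i + 1))) s := by
      refine Finset.disjoint_left.2 fun m hm hms => ?_
      have h1 : m ≤ s.sup id := Finset.le_sup (f := id) hms
      have h2 := (Finset.mem_Ico.1 hm).1
      have h3 : i < 2 ^ i := Nat.lt_two_pow_self
      omega
    have hlow : (1 / 2 : ℝ) ≤ ∑ n ∈ Finset.Ico (2 ^ i) (2 ^ (i + 1)),
        if n ∈ S then (1 : ℝ) / n else 0 := by
      have hterm : ∀ n ∈ Finset.Ico (2 ^ i) (2 ^ (i + 1)),
          (1 : ℝ) / 2 ^ (i + 1) ≤ if n ∈ S then (1 : ℝ) / n else 0 := by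
        intro n hn
        rw [Finset.mem_Ico] at hn
        rw [if_pos ((hS n).2 ⟨i, hi, hn⟩)]
        have hpos : 0 < n := (Nat.two_pow_pos i).trans_le hn.1
        exact one_div_le_one_div_of_le (by exact_mod_cast hpos) (by exact_mod_cast hn.2.le)
      refine le_trans (le_of_eq ?_) (Finset.card_nsmul_le_sum _ _ _ hterm)
      have hcard : 2 ^ (i + 1) - 2 ^ i = 2 ^ i := by rw [pow_succ]; omega
      rw [Nat.card_Ico, hcard, nsmul_eq_mul, pow_succ]
      push_cast
      field_simp
    exact absurd ((le_abs_self _).trans_lt (hs _ hdisj)) (not_lt.2 hlow)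
  · intro hD
    have hfin : S.Finite := (hD.biUnion fun i _ => Set.finite_Ico (2 ^ i) (2 ^ (i + 1))).subset
      fun m hm => by
        obtain ⟨i, hi, h⟩ := (hS m).1 hm
        exact Set.mem_biUnion hi h
    refine summable_of_hasFiniteSupport (hfin.subset fun n hn => ?_)
    by_contra hnS
    simp [hnS] at hn

theorem primrec_two_pow : Primrec fun i : ℕ => 2 ^ i :=
  (Primrec.nat_rec₁ 1 (f := fun _ x => x * 2)
    (Primrec.nat_mul.comp Primrec.snd (.const 2))).of_eq fun i => by
      induction i with
      | zero => rfl
      | succ i ih => rw [pow_succ, ← ih]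

theorem exists_computable_reduction_s17 {F : ℕ → ℕ → Prop} (hF : Equivalence F)
    (hF3 : Sigma03Rel F) : ∃ f : ℕ → ℕ, Computable f ∧ ∀ i j, F i j ↔ E2ce (f i) (f j) := by
  obtain ⟨Q, hQ, hfin⟩ := exists_sigmaOne_finite_iff hF hF3
  have hblock : SigmaOne fun p : ℕ × ℕ => ∃ t : ℕ × ℕ × ℕ × ℕ,
      (2 ^ Encodable.encode t ≤ p.2 ∧ p.2 < 2 ^ (Encodable.encode t + 1)) ∧ Q (p.1, t) := by
    refine SigmaOne.exists_of (P := fun q : (ℕ × ℕ) × ℕ × ℕ × ℕ × ℕ =>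
      (2 ^ Encodable.encode q.2 ≤ q.1.2 ∧ q.1.2 < 2 ^ (Encodable.encode q.2 + 1)) ∧ Q (q.1.1, q.2))
      (.and (.and (.of_primrecPred ?_) (.of_primrecPred ?_)) ?_)
    · exact Primrec.nat_le.comp (primrec_two_pow.comp (Primrec.encode.comp .snd))
        (Primrec.snd.comp .fst)
    · exact Primrec.nat_lt.comp (Primrec.snd.comp .fst)
        (primrec_two_pow.comp (Primrec.succ.comp (Primrec.encode.comp .snd)))
    · exact hQ.comp ((Computable.fst.comp .fst).pair .snd)
  obtain ⟨f, hf, hW⟩ := hblock.exists_index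
  refine ⟨f, hf, fun i j => ?_⟩
  classical
  rw [hfin]
  refine (Set.finite_image_iff Encodable.encode_injective.injOn).symm.trans
    (summable_dyadic_blocks_iff fun m => ?_).symm
  simp only [Set.mem_union, Set.mem_sdiff, hW, Set.mem_image, exists_exists_and_eq_and,
    Set.mem_ofPred_eq]
  have hkey : ∀ z t, (2 ^ Encodable.encode t ≤ m ∧ m < 2 ^ (Encodable.encode t + 1)) →
      ((∃ t' : ℕ × ℕ × ℕ × ℕ, (2 ^ Encodable.encode t' ≤ m ∧ m < 2 ^ (Encodable.encode t' + 1)) ∧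
        Q (z, t')) ↔ Q (z, t)) := by
    refine fun z t ht => ⟨fun ⟨t', ht', h⟩ => ?_, fun h => ⟨t, ht, h⟩⟩
    rwa [Encodable.encode_injective (dyadic_index_unique ht ht')]
  constructor
  · rintro (⟨⟨t, ht, hQt⟩, hn⟩ | ⟨⟨t, ht, hQt⟩, hn⟩)
    all_goals
      rw [hkey _ t ht] at hn
      exact ⟨t, by simp [hQt, hn], ht⟩
  · rintro ⟨t, hne, ht⟩
    rw [hkey i t ht, hkey j t ht]
    tauto

theorem equivalence_E2ce : Equivalence E2ce where
  refl i := by simp [E2ce, summable_zero]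
  symm {i j} h := by
    unfold E2ce at h ⊢
    refine h.congr fun n => ?_
    by_cases hi : n ∈ W i <;> by_cases hj : n ∈ W j <;> simp [hi, hj]
  trans {i j k} hij hjk := by
    unfold E2ce at hij hjk ⊢
    refine Summable.of_nonneg_of_le (fun n => ?_) (fun n => ?_) (Summable.add hij hjk)
    · split_ifs <;> positivity
    · have hn : (0 : ℝ) ≤ 1 / n := by positivity
      by_cases hi : n ∈ W i <;> by_cases hj : n ∈ W j <;> by_cases hk : n ∈ W k <;>
        simp [hi, hj, hk]

/-- Whether the `i`-th partial computable function halts on `n` within the bound `t`. -/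
def haltsWithin (t i n : ℕ) : Bool :=
  (Nat.Partrec.Code.evaln t (Denumerable.ofNat Nat.Partrec.Code i) n).isSome

theorem haltsWithin_mono {t t' i n : ℕ} (h : t ≤ t') (ht : haltsWithin t i n = true) :
    haltsWithin t' i n = true := by
  obtain ⟨x, hx⟩ := Option.isSome_iff_exists.1 ht
  exact Option.isSome_iff_exists.2 ⟨x, Nat.Partrec.Code.evaln_mono h hx⟩

theorem mem_W_iff_s17 {i n : ℕ} : n ∈ W i ↔ ∃ t, haltsWithin t i n = true := by
  constructor
  · intro h
    obtain ⟨t, ht⟩ := Nat.Partrec.Code.evaln_complete.1 (Part.get_mem h)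
    exact ⟨t, Option.isSome_iff_exists.2 ⟨_, ht⟩⟩
  · rintro ⟨t, ht⟩
    obtain ⟨x, hx⟩ := Option.isSome_iff_exists.1 ht
    exact Part.dom_iff_mem.2 ⟨x, Nat.Partrec.Code.evaln_sound hx⟩

theorem eventually_haltsWithin_iff (i N : ℕ) :
    ∀ᶠ t in Filter.atTop, ∀ n ∈ Finset.range N, haltsWithin t i n = true ↔ n ∈ W i := by
  refine (Filter.eventually_all_finset _).2 fun n _ => ?_
  by_cases h : n ∈ W i
  · obtain ⟨t, ht⟩ := mem_W_iff_s17.1 h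
    filter_upwards [Filter.eventually_ge_atTop t] with t' ht'
    exact iff_of_true (haltsWithin_mono ht' ht) h
  · exact .of_forall fun t => iff_of_false (fun ht => h (mem_W_iff_s17.2 ⟨t, ht⟩)) h

/-- The approximation with bound `t` to `N!` times the `N`-th partial sum of the series defining
`E2ce i j`. -/
def scaledSum (t i j N : ℕ) : ℕ :=
  ∑ n ∈ Finset.range N, bif xor (haltsWithin t i n) (haltsWithin t j n) then N.factorial / n else 0

open Classical in
theorem eventually_scaledSum_eq (i j N : ℕ) :
    ∀ᶠ t in Filter.atTop, (scaledSum t i j N : ℝ) = N.factorial *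
      ∑ n ∈ Finset.range N, if n ∈ (W i \ W j) ∪ (W j \ W i) then (1 : ℝ) / n else 0 := by
  filter_upwards [eventually_haltsWithin_iff i N, eventually_haltsWithin_iff j N] with t hi hj
  rw [scaledSum, Nat.cast_sum, Finset.mul_sum]
  refine Finset.sum_congr rfl fun n hn => ?_
  have hdvd : ((N.factorial / n : ℕ) : ℝ) = N.factorial * (1 / n) := by
    rcases Nat.eq_zero_or_pos n with rfl | hpos
    · simp
    · rw [Nat.cast_div (Nat.dvd_factorial hpos (Finset.mem_range.1 hn).le)
        (by exact_mod_cast hpos.ne'), mul_one_div]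
  simp only [Set.mem_union, Set.mem_sdiff, ← hi n hn, ← hj n hn]
  cases haltsWithin t i n <;> cases haltsWithin t j n <;> simp [hdvd]

open Classical in
theorem E2ce_iff_bounded {i j : ℕ} : E2ce i j ↔ ∃ B : ℕ, ∀ N,
    ∑ n ∈ Finset.range N, (if n ∈ (W i \ W j) ∪ (W j \ W i) then (1 : ℝ) / n else 0) ≤ B := by
  have hnonneg : ∀ n : ℕ, (0 : ℝ) ≤ if n ∈ (W i \ W j) ∪ (W j \ W i) then (1 : ℝ) / n else 0 :=
    fun n => by split_ifs <;> positivity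
  constructor
  · intro h
    obtain ⟨B, hB⟩ := exists_nat_ge (∑' n : ℕ,
      if n ∈ (W i \ W j) ∪ (W j \ W i) then (1 : ℝ) / n else 0)
    exact ⟨B, fun N => (h.sum_le_tsum _ fun n _ => hnonneg n).trans hB⟩
  · rintro ⟨B, hB⟩
    exact summable_of_sum_range_le hnonneg hB

theorem E2ce_iff_scaledSum {i j : ℕ} : E2ce i j ↔ ∃ B, ∀ p : ℕ, ∃ c,
    scaledSum (p.unpair.2 + c) i j p.unpair.1 ≤ B * p.unpair.1.factorial := by
  classical
  rw [E2ce_iff_bounded]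
  refine exists_congr fun B => ?_
  have hscale : ∀ (N : ℕ) (r : ℝ), r ≤ B ↔ N.factorial * r ≤ ((B * N.factorial : ℕ) : ℝ) := by
    intro N r
    rw [Nat.cast_mul, mul_comm (B : ℝ), mul_le_mul_iff_right₀ (by exact_mod_cast N.factorial_pos)]
  constructor
  · intro h p
    obtain ⟨t, ht, hle⟩ := ((eventually_scaledSum_eq i j p.unpair.1).and
      (Filter.eventually_ge_atTop p.unpair.2)).exists
    refine ⟨t - p.unpair.2, ?_⟩
    rw [Nat.add_sub_cancel' hle, ← Nat.cast_le (α := ℝ), ht, ← hscale]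
    exact h _
  · intro h N
    obtain ⟨s, hs⟩ := Filter.eventually_atTop.1 (eventually_scaledSum_eq i j N)
    obtain ⟨c, hc⟩ := h (Nat.pair N s)
    rw [Nat.unpair_pair, ← Nat.cast_le (α := ℝ), hs _ (Nat.le_add_right s c)] at hc
    exact (hscale N _).2 hc

theorem primrec_factorial : Primrec Nat.factorial :=
  (Primrec.nat_rec₁ 1 (f := fun n x => (n + 1) * x)
    (Primrec.nat_mul.comp (Primrec.succ.comp Primrec.fst) .snd)).of_eq fun n => by
      induction n with
      | zero => rfl
      | succ n ih => rw [Nat.factorial_succ, ← ih]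

theorem primrec_haltsWithin :
    Primrec fun p : ℕ × ℕ × ℕ => haltsWithin p.1 p.2.1 p.2.2 :=
  Primrec.option_isSome.comp (Nat.Partrec.Code.primrec_evaln.comp
    ((Primrec.fst.pair ((Primrec.ofNat _).comp (Primrec.fst.comp .snd))).pair
      (Primrec.snd.comp .snd)))

theorem primrec_scaledSum :
    Primrec fun p : (ℕ × ℕ) × ℕ × ℕ => scaledSum p.1.1 p.2.1 p.2.2 p.1.2 := by
  have hterm : Primrec fun q : ((ℕ × ℕ) × ℕ × ℕ) × ℕ × ℕ =>
      q.2.2 + bif xor (haltsWithin q.1.1.1 q.1.2.1 q.2.1) (haltsWithin q.1.1.1 q.1.2.2 q.2.1)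
        then q.1.1.2.factorial / q.2.1 else 0 := by
    have ht : Primrec fun q : ((ℕ × ℕ) × ℕ × ℕ) × ℕ × ℕ => q.1.1.1 := Primrec.fst.comp (Primrec.fst.comp .fst)
    have hN : Primrec fun q : ((ℕ × ℕ) × ℕ × ℕ) × ℕ × ℕ => q.1.1.2 := Primrec.snd.comp (Primrec.fst.comp .fst)
    have hi : Primrec fun q : ((ℕ × ℕ) × ℕ × ℕ) × ℕ × ℕ => q.1.2.1 := Primrec.fst.comp (Primrec.snd.comp .fst)
    have hj : Primrec fun q : ((ℕ × ℕ) × ℕ × ℕ) × ℕ × ℕ => q.1.2.2 := Primrec.snd.comp (Primrec.snd.comp .fst)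
    have hn : Primrec fun q : ((ℕ × ℕ) × ℕ × ℕ) × ℕ × ℕ => q.2.1 := Primrec.fst.comp .snd
    exact Primrec.nat_add.comp (Primrec.snd.comp .snd) (Primrec.cond
      ((Primrec.dom_bool₂ xor).comp (primrec_haltsWithin.comp (ht.pair (hi.pair hn)))
        (primrec_haltsWithin.comp (ht.pair (hj.pair hn))))
      (Primrec.nat_div.comp (primrec_factorial.comp hN) hn) (.const 0))
  have hN : Primrec fun p : (ℕ × ℕ) × ℕ × ℕ => p.1.2 := Primrec.snd.comp .fst
  refine (Primrec.nat_rec' hN (.const 0) (h := fun (p : (ℕ × ℕ) × ℕ × ℕ) (q : ℕ × ℕ) => q.2 + bif xor (haltsWithin p.1.1 p.2.1 q.1)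
    (haltsWithin p.1.1 p.2.2 q.1) then p.1.2.factorial / q.1 else 0) hterm).of_eq fun p => ?_
  have hrec : ∀ m, (Nat.rec 0 (fun n x => x + bif xor (haltsWithin p.1.1 p.2.1 n)
      (haltsWithin p.1.1 p.2.2 n) then p.1.2.factorial / n else 0) m : ℕ) =
      ∑ n ∈ Finset.range m, bif xor (haltsWithin p.1.1 p.2.1 n) (haltsWithin p.1.1 p.2.2 n)
        then p.1.2.factorial / n else 0 := by
    intro m
    induction m with
    | zero => rfl
    | succ m ih => rw [Finset.sum_range_succ, ← ih]
  exact hrec p.1.2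

theorem sigma03Rel_E2ce : Sigma03Rel E2ce := by
  refine ⟨fun i j a b c => decide (scaledSum (b.unpair.2 + c) i j b.unpair.1 ≤
    a * b.unpair.1.factorial), Primrec.to_comp ?_, fun i j => by simp [E2ce_iff_scaledSum]⟩
  have hj : Primrec fun p : ℕ × ℕ × ℕ × ℕ × ℕ => p.2.1 := Primrec.fst.comp .snd
  have h2 : Primrec fun p : ℕ × ℕ × ℕ × ℕ × ℕ => p.2.2 := Primrec.snd.comp .snd
  have hb := Primrec.unpair.comp (Primrec.fst.comp (Primrec.snd.comp h2))
  have hc := Primrec.snd.comp (Primrec.snd.comp h2)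
  have hN := Primrec.fst.comp hb
  exact PrimrecPred.decide (Primrec.nat_le.comp
    (primrec_scaledSum.comp
      (((Primrec.nat_add.comp (Primrec.snd.comp hb) hc).pair hN).pair (Primrec.fst.pair hj)))
    (Primrec.nat_mul.comp (Primrec.fst.comp h2) (primrec_factorial.comp hN)))

/-- `E₂^{ce}` is a Σ⁰₃-complete equivalence relation. -/
theorem stmt_17 :
    Equivalence E2ce ∧ Sigma03Rel E2ce ∧
    ∀ F : ℕ → ℕ → Prop, Equivalence F → Sigma03Rel F →
      ∃ f : ℕ → ℕ, Computable f ∧ ∀ i j, F i j ↔ E2ce (f i) (f j) :=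
  ⟨equivalence_E2ce, sigma03Rel_E2ce, fun _ hF hF3 => exists_computable_reduction_s17 hF hF3⟩
end
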